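/- arXiv:1907.03531 — 5 statements merged into one kernel-verified Lean document; each statement's English description precedes it below -/
import Mathlib

section
/- Let S be a nonempty finite set of flags and let τ0, τ1, τ2 be permutations of S, each a fixed-point-free involution, such that the composite τ0 ∘ τ2 is also a fixed-point-free involution. If the subgroup of permutations generated by τ0, τ1, τ2 acts transitively on S, then V − E + F ≤ 2, where V is the number of orbits of the subgroup generated by τ1 and τ2, E is the number of orbits of the subgroup generated by τ0 and τ2, and F is the number of orbits of the subgroup generated by τ0 and τ1. Equivalently, the non-orientable genus k := 2 − (V − E + F) of a connected (possibly non-orientable) combinatorial map is a non-negative integer. -/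
/-- The quotient of `S` by the subgroup of permutations generated by `T`. -/
abbrev PermOrbits {S : Type*} (T : Set (Equiv.Perm S)) : Type _ :=
  MulAction.orbitRel.Quotient (Subgroup.closure T) S

namespace PermOrbits

variable {S : Type*}

/-- The orbit of a point. -/
def mk (T : Set (Equiv.Perm S)) (s : S) : PermOrbits T :=
  Quotient.mk _ s

lemma mk_surjective (T : Set (Equiv.Perm S)) : Function.Surjective (mk T) :=
  Quotient.mk_surjective

lemma mk_eq_mk_iff {T : Set (Equiv.Perm S)} {s t : S} :
    mk T s = mk T t ↔ ∃ g ∈ Subgroup.closure T, g t = s := by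
  simp only [mk, Quotient.eq, MulAction.orbitRel_apply, MulAction.mem_orbit_iff, Subtype.exists,
    Subgroup.mk_smul, Equiv.Perm.smul_def, exists_prop]

lemma mk_apply {T : Set (Equiv.Perm S)} {σ : Equiv.Perm S} (hσ : σ ∈ T) (s : S) :
    mk T (σ s) = mk T s :=
  mk_eq_mk_iff.2 ⟨σ, Subgroup.subset_closure hσ, rfl⟩

lemma apply_eq_of_mem_closure {α : Type*} {T : Set (Equiv.Perm S)} {φ : S → α}
    (hφ : ∀ σ ∈ T, ∀ s, φ (σ s) = φ s) {g : Equiv.Perm S} (hg : g ∈ Subgroup.closure T) (s : S) :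
    φ (g s) = φ s := by
  induction hg using Subgroup.closure_induction generalizing s with
  | mem σ hσ => exact hφ σ hσ s
  | one => rfl
  | mul x y _ _ hx hy => rw [Equiv.Perm.mul_apply, hx, hy]
  | inv x _ hx => simpa using (hx (x⁻¹ s)).symm

/-- A function invariant under `T` descends to the orbits. -/
def lift {α : Type*} {T : Set (Equiv.Perm S)} (φ : S → α)
    (hφ : ∀ σ ∈ T, ∀ s, φ (σ s) = φ s) : PermOrbits T → α :=
  Quotient.lift φ fun s t hst => by
    obtain ⟨g, hg, rfl⟩ := mk_eq_mk_iff.1 (Quotient.sound hst : mk T s = mk T t)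
    exact apply_eq_of_mem_closure hφ hg t

@[simp]
lemma lift_mk {α : Type*} {T : Set (Equiv.Perm S)} (φ : S → α)
    (hφ : ∀ σ ∈ T, ∀ s, φ (σ s) = φ s) (s : S) : lift φ hφ (mk T s) = φ s :=
  rfl

/-- The mod 2 coboundary map, sending a function `f` on the `T`-orbits to the function
`s ↦ f [s] + f [σ s]` on the `U`-orbits. -/
def coboundary (T U : Set (Equiv.Perm S)) (σ : Equiv.Perm S)
    (h : ∀ (f : PermOrbits T → ZMod 2), ∀ ρ ∈ U, ∀ s,
      f (mk T (ρ s)) + f (mk T (σ (ρ s))) = f (mk T s) + f (mk T (σ s))) :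
    (PermOrbits T → ZMod 2) →ₗ[ZMod 2] (PermOrbits U → ZMod 2) where
  toFun f := lift (fun s => f (mk T s) + f (mk T (σ s))) (h f)
  map_add' f g := by
    ext e
    obtain ⟨s, rfl⟩ := mk_surjective U e
    simp only [lift_mk, Pi.add_apply]
    ring
  map_smul' c f := by
    ext e
    obtain ⟨s, rfl⟩ := mk_surjective U e
    simp only [lift_mk, Pi.smul_apply, smul_eq_mul, RingHom.id_apply]
    ring

/-- The coboundary map on a connected map has at most a one-dimensional kernel. -/
lemma card_le_finrank_range_coboundary_add_one [Finite S] {T U : Set (Equiv.Perm S)}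
    {σ : Equiv.Perm S} (h)
    (hconn : MulAction.IsPretransitive (Subgroup.closure (insert σ T)) S) :
    Nat.card (PermOrbits T) ≤ Module.finrank (ZMod 2) (coboundary T U σ h).range + 1 := by
  have := Fintype.ofFinite (PermOrbits T)
  have hker : Module.finrank (ZMod 2) (coboundary T U σ h).ker ≤ 1 := by
    rcases isEmpty_or_nonempty S with hS | ⟨⟨s₀⟩⟩
    · have : IsEmpty (PermOrbits T) := (mk_surjective T).isEmpty
      simp [Module.finrank_zero_of_subsingleton]
    have hconst : ∀ f ∈ (coboundary T U σ h).ker, ∀ s, f (mk T s) = f (mk T s₀) := by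
      intro f hf s
      obtain ⟨⟨g, hg⟩, rfl⟩ := hconn.exists_smul_eq s₀ s
      refine apply_eq_of_mem_closure (φ := fun s => f (mk T s)) ?_ hg s₀
      rintro ρ (rfl | hρ) t
      · have ht : f (mk T t) + f (mk T (ρ t)) = 0 :=
          congrFun (LinearMap.mem_ker.1 hf) (mk U t)
        exact (CharTwo.add_eq_zero.1 ht).symm
      · exact congrArg f (mk_apply hρ t)
    let ev : (coboundary T U σ h).ker →ₗ[ZMod 2] ZMod 2 :=
      (LinearMap.proj (mk T s₀)).comp (coboundary T U σ h).ker.subtype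
    have hev : Function.Injective ev := by
      intro f g hfg
      ext e
      obtain ⟨s, rfl⟩ := mk_surjective T e
      rw [hconst f f.2 s, hconst g g.2 s]
      exact hfg
    simpa using LinearMap.finrank_le_finrank_of_injective hev
  have := (coboundary T U σ h).finrank_range_add_finrank_ker
  rw [Module.finrank_fintype_fun_eq_card, ← Nat.card_eq_fintype_card] at this
  omega

/-- Two linear maps with orthogonal ranges have total rank at most the dimension. -/
lemma _root_.LinearMap.finrank_range_add_finrank_range_le_card {K ι κ μ : Type*} [Field K]
    [Fintype ι] [Fintype κ] [Fintype μ] (f : (ι → K) →ₗ[K] (μ → K)) (g : (κ → K) →ₗ[K] (μ → K))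
    (h : ∀ x y, f x ⬝ᵥ g y = 0) :
    Module.finrank K f.range + Module.finrank K g.range ≤ Fintype.card μ := by
  classical
  let A := f.toMatrix'
  let B := g.toMatrix'
  have hA : Module.finrank K f.range = A.transpose.rank := by
    rw [Matrix.rank_transpose, Matrix.rank, ← Matrix.toLin'_apply', Matrix.toLin'_toMatrix']
  have hB : Module.finrank K g.range = B.rank := by
    rw [Matrix.rank, ← Matrix.toLin'_apply', Matrix.toLin'_toMatrix']
  have hAB : A.transpose * B = 0 := by
    ext i j
    have := h (Pi.single i 1) (Pi.single j 1)
    simpa [A, B, Matrix.mul_apply, LinearMap.toMatrix'_apply, dotProduct] using this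
  rw [hA, hB]
  exact Matrix.rank_add_rank_le_card_of_mul_eq_zero hAB

/-- Summing the orbit sums of a free action of the Klein four-group gives the total sum. -/
lemma sum_eq_sum_klein_orbits [Fintype S] {a b : Equiv.Perm S} [Fintype (PermOrbits {a, b})]
    (ha : ∀ s, a (a s) = s) (hb : ∀ s, b (b s) = s) (hab : ∀ s, a (b s) = b (a s))
    (ha' : ∀ s, a s ≠ s) (hb' : ∀ s, b s ≠ s) (hab' : ∀ s, a (b s) ≠ s)
    (φ : S → ZMod 2) (ψ : PermOrbits {a, b} → ZMod 2)
    (h : ∀ s, ψ (mk _ s) = φ s + φ (a s) + φ (b s) + φ (a (b s))) :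
    ∑ e, ψ e = ∑ s, φ s := by
  classical
  rw [← Finset.sum_fiberwise Finset.univ (mk {a, b}) φ]
  refine Finset.sum_congr rfl fun e _ => ?_
  obtain ⟨s, rfl⟩ := mk_surjective _ e
  have hfiber : ({t | mk {a, b} t = mk {a, b} s} : Finset S) = {s, a s, b s, a (b s)} := by
    ext t
    simp only [Finset.mem_filter, Finset.mem_univ, true_and, Finset.mem_insert,
      Finset.mem_singleton]
    constructor
    · intro ht
      obtain ⟨g, hg, rfl⟩ := mk_eq_mk_iff.1 ht
      have := apply_eq_of_mem_closure (T := {a, b})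
        (φ := fun t => t = s ∨ t = a s ∨ t = b s ∨ t = a (b s)) ?_ hg s
      · simpa using this
      · rintro σ (rfl | rfl) t <;> grind
    · have hA := mk_apply (T := {a, b}) (σ := a) (by simp)
      have hB := mk_apply (T := {a, b}) (σ := b) (by simp)
      rintro (rfl | rfl | rfl | rfl) <;> simp only [hA, hB]
  rw [hfiber, h, Finset.sum_insert (by grind), Finset.sum_insert (by grind),
    Finset.sum_insert (by grind), Finset.sum_singleton]
  ring

end PermOrbits


/-- **Euler characteristic bound for connected combinatorial maps.**
A (possibly non-orientable) combinatorial map is encoded by a nonempty finite type `S` of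
flags together with three fixed-point-free involutive permutations `τ0, τ1, τ2` such that
`τ0 * τ2` is also a fixed-point-free involution.  If the subgroup generated by
`τ0, τ1, τ2` acts transitively on `S` (the map is connected) then
`V - E + F ≤ 2`, where `V`, `E`, `F` are the numbers of orbits of the subgroups generated
by `{τ1, τ2}`, `{τ0, τ2}` and `{τ0, τ1}` respectively.  Equivalently, the non-orientable
genus `k = 2 - (V - E + F)` is a non-negative integer. -/
theorem connected_map_euler_char_le_two
    (S : Type) [Fintype S] [Nonempty S]
    (τ0 τ1 τ2 : Equiv.Perm S)
    (h0 : τ0 * τ0 = 1) (h0' : ∀ s, τ0 s ≠ s)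
    (h1 : τ1 * τ1 = 1) (h1' : ∀ s, τ1 s ≠ s)
    (h2 : τ2 * τ2 = 1) (h2' : ∀ s, τ2 s ≠ s)
    (h02 : (τ0 * τ2) * (τ0 * τ2) = 1) (h02' : ∀ s, (τ0 * τ2) s ≠ s)
    (hconn : MulAction.IsPretransitive (Subgroup.closure {τ0, τ1, τ2} : Subgroup (Equiv.Perm S)) S) :
    (Nat.card (MulAction.orbitRel.Quotient (Subgroup.closure {τ1, τ2} : Subgroup (Equiv.Perm S)) S) : ℤ)
      - (Nat.card (MulAction.orbitRel.Quotient (Subgroup.closure {τ0, τ2} : Subgroup (Equiv.Perm S)) S) : ℤ)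
      + (Nat.card (MulAction.orbitRel.Quotient (Subgroup.closure {τ0, τ1} : Subgroup (Equiv.Perm S)) S) : ℤ)
      ≤ 2 := by
  classical
  have k0 : ∀ s, τ0 (τ0 s) = s := fun s => Equiv.congr_fun h0 s
  have k1 : ∀ s, τ1 (τ1 s) = s := fun s => Equiv.congr_fun h1 s
  have k2 : ∀ s, τ2 (τ2 s) = s := fun s => Equiv.congr_fun h2 s
  have k02 : ∀ s, τ0 (τ2 s) = τ2 (τ0 s) := fun s => by
    have := Equiv.congr_fun h02 (τ2 (τ0 s))
    simpa [k0, k2] using this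
  let mkV := PermOrbits.mk {τ1, τ2}
  let mkF := PermOrbits.mk {τ0, τ1}
  have V1 : ∀ s, mkV (τ1 s) = mkV s := PermOrbits.mk_apply (by simp)
  have V2 : ∀ s, mkV (τ2 s) = mkV s := PermOrbits.mk_apply (by simp)
  have F0 : ∀ s, mkF (τ0 s) = mkF s := PermOrbits.mk_apply (by simp)
  have F1 : ∀ s, mkF (τ1 s) = mkF s := PermOrbits.mk_apply (by simp)
  have hV : ∀ (f : PermOrbits {τ1, τ2} → ZMod 2), ∀ ρ ∈ ({τ0, τ2} : Set (Equiv.Perm S)), ∀ s,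
      f (mkV (ρ s)) + f (mkV (τ0 (ρ s))) = f (mkV s) + f (mkV (τ0 s)) := by
    rintro f ρ (rfl | rfl) s
    · rw [k0, add_comm]
    · rw [k02, V2, V2]
  have hF : ∀ (f : PermOrbits {τ0, τ1} → ZMod 2), ∀ ρ ∈ ({τ0, τ2} : Set (Equiv.Perm S)), ∀ s,
      f (mkF (ρ s)) + f (mkF (τ2 (ρ s))) = f (mkF s) + f (mkF (τ2 s)) := by
    rintro f ρ (rfl | rfl) s
    · rw [← k02, F0, F0]
    · rw [k2, add_comm]
  have := Fintype.ofFinite (PermOrbits {τ1, τ2})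
  have := Fintype.ofFinite (PermOrbits {τ0, τ2})
  have := Fintype.ofFinite (PermOrbits {τ0, τ1})
  have horth : ∀ f g, PermOrbits.coboundary {τ1, τ2} {τ0, τ2} τ0 hV f ⬝ᵥ
      PermOrbits.coboundary {τ0, τ1} {τ0, τ2} τ2 hF g = 0 := by
    intro f g
    rw [dotProduct, PermOrbits.sum_eq_sum_klein_orbits k0 k2 k02 h0' h2' h02'
      (fun s => f (mkV s) * g (mkF s))]
    · refine Finset.sum_involution (fun s _ => τ1 s) (fun s _ => ?_) (fun s _ _ => h1' s)
        (fun s _ => Finset.mem_univ _) (fun s _ => k1 s)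
      rw [V1, F1]
      exact CharTwo.add_self_eq_zero _
    · intro s
      change (f (mkV s) + f (mkV (τ0 s))) * (g (mkF s) + g (mkF (τ2 s))) = _
      rw [F0, V2, F0, k02, V2]
      ring
  have hrank := LinearMap.finrank_range_add_finrank_range_le_card _ _ horth
  have hVle := PermOrbits.card_le_finrank_range_coboundary_add_one hV hconn
  have hFle := PermOrbits.card_le_finrank_range_coboundary_add_one hF
    (by rwa [Set.insert_comm, Set.pair_comm τ2 τ1])
  rw [← Nat.card_eq_fintype_card] at hrank
  unfold PermOrbits at hrank hVle hFle
  omega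
end

section
/- Fix an integer D ≥ 2 and a connected edge (D+1)-colored graph (V, σ_0, …, σ_D) with V nonempty. Let π be a permutation of the color set {0, 1, …, D} whose cycle decomposition consists of a single cycle of length D+1 (a 'jacket'). Then the number of faces of the jacket satisfies 2 · Σ_{p=0}^{D} F^{(π^p(0), π^{p+1}(0))} ≤ 4 + (D−1)·|V|, where F^{(i,j)} denotes the number of faces with colors (ij). -/
namespace ColoredGraph

open Module

variable {V ι : Type*}

/-- The rational functions on `V` that are invariant under every permutation in `S`. -/
def invariants (S : Set (Equiv.Perm V)) : Submodule ℚ (V → ℚ) where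
  carrier := {f | ∀ s ∈ S, ∀ v, f (s v) = f v}
  add_mem' hf hg s hs v := by simp [hf s hs v, hg s hs v]
  zero_mem' _ _ _ := rfl
  smul_mem' c f hf s hs v := by simp [hf s hs v]

theorem apply_smul_of_mem_invariants {S : Set (Equiv.Perm V)} {f : V → ℚ}
    (hf : f ∈ invariants S) (g : Subgroup.closure S) (v : V) : f (g • v) = f v := by
  obtain ⟨g, hg⟩ := g
  change f (g v) = f v
  induction hg using Subgroup.closure_induction generalizing v with
  | mem s hs => exact hf s hs v
  | one => rfl
  | mul a b _ _ ha hb => rw [Equiv.Perm.mul_apply, ha, hb]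
  | inv a _ ha => rw [← ha, ← Equiv.Perm.mul_apply, mul_inv_cancel, Equiv.Perm.one_apply]

/-- Invariant functions are the same as functions on the orbits. -/
noncomputable def invariantsEquiv (S : Set (Equiv.Perm V)) :
    (MulAction.orbitRel.Quotient (Subgroup.closure S) V → ℚ) ≃ₗ[ℚ] invariants S where
  toFun h := ⟨fun v => h (Quotient.mk _ v), fun s hs v => congrArg h <| Quotient.sound
    ⟨⟨s, Subgroup.subset_closure hs⟩, rfl⟩⟩
  map_add' _ _ := rfl
  map_smul' _ _ := rfl
  invFun f q := Quotient.liftOn q f.1 <| by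
    rintro _ b ⟨g, rfl⟩
    exact apply_smul_of_mem_invariants f.2 g b
  left_inv h := funext fun q => Quotient.inductionOn q fun _ => rfl
  right_inv _ := rfl

theorem finrank_invariants [Finite V] (S : Set (Equiv.Perm V)) :
    finrank ℚ (invariants S) =
      Nat.card (MulAction.orbitRel.Quotient (Subgroup.closure S) V) := by
  have := Fintype.ofFinite (MulAction.orbitRel.Quotient (Subgroup.closure S) V)
  rw [← (invariantsEquiv S).finrank_eq, finrank_fintype_fun_eq_card, Nat.card_eq_fintype_card]

/-- A fixed-point-free involution has at most `|V| / 2` orbits. -/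
theorem two_mul_card_orbits_le [Finite V] {s : Equiv.Perm V} (hfpf : ∀ v, s v ≠ v) :
    2 * Nat.card (MulAction.orbitRel.Quotient (Subgroup.closure {s}) V) ≤ Nat.card V := by
  let Q := MulAction.orbitRel.Quotient (Subgroup.closure {s}) V
  have hs : ∀ v : V, (Quotient.mk _ (s v) : Q) = Quotient.mk _ v := fun v =>
    Quotient.sound ⟨⟨s, Subgroup.subset_closure rfl⟩, rfl⟩
  have hinj : Function.Injective
      (fun x : Bool × Q => if x.1 then s x.2.out else x.2.out) := by
    have hmk : ∀ x : Bool × Q,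
        (Quotient.mk _ (if x.1 then s x.2.out else x.2.out) : Q) = x.2 := by
      rintro ⟨_ | _, q⟩
      · exact Quotient.out_eq q
      · exact (hs _).trans (Quotient.out_eq q)
    rintro ⟨b, q⟩ ⟨c, r⟩ h
    obtain rfl : q = r := by
      exact (hmk (b, q)).symm.trans ((congrArg _ h).trans (hmk (c, r)))
    cases b <;> cases c
    · rfl
    · exact absurd h.symm (hfpf _)
    · exact absurd h (hfpf _)
    · rfl
  simpa [Nat.card_prod] using Nat.card_le_card_of_injective _ hinj

/-- A property that propagates along the edges of a connected graph holds at every vertex. -/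
theorem forall_of_isPretransitive {σ : ι → Equiv.Perm V} (hinv : ∀ i, σ i * σ i = 1)
    (hconn : MulAction.IsPretransitive (Subgroup.closure (Set.range σ)) V)
    {P : V → Prop} {v₀ : V} (h₀ : P v₀) (hstep : ∀ i v, P v → P (σ i v)) (v : V) : P v := by
  obtain ⟨⟨g, hg⟩, rfl⟩ := hconn.exists_smul_eq v₀ v
  change P (g v₀)
  have key : ∀ w, P (g w) ↔ P w := by
    induction hg using Subgroup.closure_induction with
    | mem s hs =>
      obtain ⟨i, rfl⟩ := hs
      refine fun w => ⟨fun h => ?_, hstep i w⟩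
      simpa [← Equiv.Perm.mul_apply, hinv i] using hstep i _ h
    | one => exact fun _ => Iff.rfl
    | mul a b _ _ ha hb => exact fun w => (ha _).trans (hb w)
    | inv a _ ha =>
      intro w
      rw [← ha, ← Equiv.Perm.mul_apply, mul_inv_cancel, Equiv.Perm.one_apply]
  exact (key v₀).2 h₀

/-- The boundary map from faces to edges of the surface cut out by the cyclic order `π`. -/
def faceBoundary (σ : ι → Equiv.Perm V) (π : Equiv.Perm ι) :
    (∀ i, invariants {σ i, σ (π i)}) →ₗ[ℚ] ∀ i, invariants {σ i} where
  toFun g i := ⟨(g i).1 - (g (π.symm i)).1, by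
    rintro s rfl v
    have h₁ := (g i).2 (σ i) (by simp) v
    have h₂ := (g (π.symm i)).2 (σ i) (by simp) v
    simp [h₁, h₂]⟩
  map_add' g h := by ext i v; simp; ring
  map_smul' c g := by ext i v; simp; ring

/-- The boundary map from edges to vertices, with unsigned incidences. -/
def edgeBoundary [Fintype ι] (σ : ι → Equiv.Perm V) :
    (∀ i, invariants {σ i}) →ₗ[ℚ] V → ℚ where
  toFun f := ∑ i, (f i).1
  map_add' f g := by simp [Finset.sum_add_distrib]
  map_smul' c f := by simp [Finset.smul_sum]

theorem range_faceBoundary_le [Fintype ι] (σ : ι → Equiv.Perm V) (π : Equiv.Perm ι) :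
    LinearMap.range (faceBoundary σ π) ≤ LinearMap.ker (edgeBoundary σ) := by
  rintro _ ⟨g, rfl⟩
  change ∑ i, ((g i).1 - (g (π.symm i)).1) = 0
  rw [Finset.sum_sub_distrib, Equiv.sum_comp π.symm (fun i => (g i).1), sub_self]

theorem finrank_ker_faceBoundary_le [Nonempty V] {σ : ι → Equiv.Perm V}
    {π : Equiv.Perm ι} (hinv : ∀ i, σ i * σ i = 1)
    (hconn : MulAction.IsPretransitive (Subgroup.closure (Set.range σ)) V)
    (hπ : ∀ i j, π.SameCycle i j) :
    finrank ℚ (LinearMap.ker (faceBoundary σ π)) ≤ 1 := by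
  obtain ⟨v₀⟩ := ‹Nonempty V›
  let u : LinearMap.ker (faceBoundary σ π) :=
    ⟨fun i => ⟨1, fun _ _ _ => rfl⟩, by ext i v; simp [faceBoundary]⟩
  rcases isEmpty_or_nonempty ι with hι | ⟨⟨i₀⟩⟩
  · exact finrank_le_one u fun w => ⟨0, Subtype.ext <| Subsingleton.elim _ _⟩
  refine finrank_le_one u fun w => ⟨(w.1 i₀).1 v₀, ?_⟩
  have hπw : ∀ i, (w.1 (π i)).1 = (w.1 i).1 := fun i => by
    have := congrArg Subtype.val (congrFun w.2 (π i))
    exact (sub_eq_zero.1 this).trans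
      (congrArg (fun j => (w.1 j).1) (π.symm_apply_apply i))
  have hconst : ∀ i j, (w.1 i).1 = (w.1 j).1 := fun i j => by
    obtain ⟨k, rfl⟩ := hπ j i
    induction k using Int.induction_on with
    | zero => rfl
    | succ n ih => rw [add_comm, zpow_add, zpow_one, Equiv.Perm.mul_apply, hπw, ih]
    | pred n ih =>
      rw [← ih, ← hπw, ← Equiv.Perm.mul_apply, ← zpow_one_add, add_sub_cancel]
  have hw : ∀ v, (w.1 i₀).1 v = (w.1 i₀).1 v₀ := by
    refine forall_of_isPretransitive hinv hconn rfl fun i v hv => ?_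
    rw [← hv, hconst i₀ i]
    exact (w.1 i).2 (σ i) (by simp) v
  ext i v
  simp [u, hconst i i₀, hw v]

theorem card_le_finrank_range_edgeBoundary [Fintype ι] [Fintype V] [Nonempty V]
    {σ : ι → Equiv.Perm V} (hinv : ∀ i, σ i * σ i = 1)
    (hconn : MulAction.IsPretransitive (Subgroup.closure (Set.range σ)) V) :
    Nat.card V ≤ finrank ℚ (LinearMap.range (edgeBoundary σ)) + 1 := by
  classical
  obtain ⟨v₀⟩ := ‹Nonempty V›
  let e : V → V → ℚ := fun v => Pi.single v 1
  let W := LinearMap.range (edgeBoundary σ) ⊔ Submodule.span ℚ {e v₀}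
  have hedge : ∀ i v, e v + e (σ i v) ∈ LinearMap.range (edgeBoundary σ) := fun i v => by
    have hσ : ∀ w, σ i (σ i w) = w := fun w => by rw [← Equiv.Perm.mul_apply, hinv]; rfl
    have hmem : e v + e (σ i v) ∈ invariants {σ i} := by
      rintro s rfl w
      have : σ i w = v ↔ w = σ i v := ⟨fun h => by rw [← h, hσ], fun h => by rw [h, hσ]⟩
      simp [e, Pi.single_apply, this, add_comm]
    refine ⟨Pi.single i ⟨_, hmem⟩, ?_⟩
    change ∑ j, ((Pi.single i ⟨_, hmem⟩ : ∀ j, invariants {σ j}) j).1 = _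
    rw [Finset.sum_eq_single i]
    · simp
    · intro j _ hj
      simp [Pi.single_eq_of_ne hj]
    · simp
  have hW : ∀ v, e v ∈ W := by
    refine forall_of_isPretransitive hinv hconn
      (Submodule.mem_sup_right (Submodule.mem_span_singleton_self _)) fun i v hv => ?_
    simpa using W.sub_mem (Submodule.mem_sup_left (hedge i v)) hv
  have htop : W = ⊤ := by
    rw [eq_top_iff, ← (Pi.basisFun ℚ V).span_eq, Submodule.span_le]
    rintro _ ⟨v, rfl⟩
    simpa [e] using hW v
  calc Nat.card V = finrank ℚ W := by
        rw [htop, finrank_top, finrank_fintype_fun_eq_card, Nat.card_eq_fintype_card]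
    _ ≤ _ := (Submodule.finrank_add_le_finrank_add_finrank _ _).trans
        (Nat.add_le_add_left (by simpa using finrank_span_le_card (R := ℚ) {e v₀}) _)

/-- The surface cut out by a cyclic order of the colors has Euler characteristic at most `2`. -/
theorem two_mul_sum_card_faces_add_le [Fintype ι] [Fintype V] [Nonempty V]
    {σ : ι → Equiv.Perm V} {π : Equiv.Perm ι} (hinv : ∀ i, σ i * σ i = 1)
    (hfpf : ∀ i v, σ i v ≠ v)
    (hconn : MulAction.IsPretransitive (Subgroup.closure (Set.range σ)) V)
    (hπ : ∀ i j, π.SameCycle i j) :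
    2 * ∑ i, Nat.card (MulAction.orbitRel.Quotient (Subgroup.closure {σ i, σ (π i)}) V)
      + 2 * Nat.card V ≤ 4 + Fintype.card ι * Nat.card V := by
  have hfaces := (faceBoundary σ π).finrank_range_add_finrank_ker
  have hedges := (edgeBoundary σ).finrank_range_add_finrank_ker
  have hle := Submodule.finrank_mono (range_faceBoundary_le σ π)
  have hker := finrank_ker_faceBoundary_le hinv hconn hπ
  have hrange := card_le_finrank_range_edgeBoundary hinv hconn
  simp only [finrank_pi_fintype, finrank_invariants] at hfaces hedges
  have hcard : 2 * ∑ i, Nat.card (MulAction.orbitRel.Quotient (Subgroup.closure {σ i}) V) ≤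
      Fintype.card ι * Nat.card V := by
    rw [Finset.mul_sum]
    simpa using Finset.sum_le_card_nsmul Finset.univ _ _
      fun i _ => two_mul_card_orbits_le (hfpf i)
  omega

end ColoredGraph


/-- **Face count bound for a jacket of a connected edge `(D+1)`-colored graph.**
An edge `(D+1)`-colored graph is a finite nonempty vertex type `V` together with
fixed-point-free involutions `σ 0, …, σ D`; the faces with colors `(i,j)` are the
orbits of the subgroup generated by `σ i` and `σ j`.  For a permutation `π` of the
colors consisting of a single cycle of length `D+1` (a jacket), the number of faces of
the jacket satisfies `2 · Σ_{p=0}^{D} F^{(π^p(0), π^{p+1}(0))} ≤ 4 + (D-1)·|V|`. -/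
theorem jacket_face_count_bound
    (D : ℕ) (hD : 2 ≤ D)
    (V : Type) [Fintype V] [Nonempty V]
    (σ : Fin (D + 1) → Equiv.Perm V)
    (hinv : ∀ i, σ i * σ i = 1) (hfpf : ∀ i v, σ i v ≠ v)
    (hconn : MulAction.IsPretransitive
      (Subgroup.closure (Set.range σ) : Subgroup (Equiv.Perm V)) V)
    (π : Equiv.Perm (Fin (D + 1)))
    (hπ : π.IsCycle ∧ π.support.card = D + 1) :
    2 * (∑ p ∈ Finset.range (D + 1),
        Nat.card (MulAction.orbitRel.Quotient
          (Subgroup.closure {σ ((π ^ p) 0), σ ((π ^ (p + 1)) 0)} : Subgroup (Equiv.Perm V)) V))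
      ≤ 4 + (D - 1) * Nat.card V := by
  have hfix : ∀ i, π i ≠ i := fun i => by
    rw [← Equiv.Perm.mem_support,
      (Finset.card_eq_iff_eq_univ _).1 (hπ.2.trans (Fintype.card_fin _).symm)]
    exact Finset.mem_univ i
  have hord : orderOf π = D + 1 := hπ.1.orderOf.trans hπ.2
  have hsame : ∀ i j, π.SameCycle i j := fun i j => hπ.1.sameCycle (hfix i) (hfix j)
  have hsum : ∀ f : Fin (D + 1) → ℕ,
      ∑ p ∈ Finset.range (D + 1), f ((π ^ p) 0) = ∑ i, f i := fun f => by
    have hsurj : Function.Surjective (fun p : Fin (D + 1) => (π ^ (p : ℕ)) 0) := fun j => by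
      obtain ⟨p, hp, rfl⟩ := (hsame 0 j).exists_pow_eq'
      exact ⟨⟨p, hp.trans_eq hord⟩, rfl⟩
    rw [Finset.sum_range]
    exact (Finite.injective_iff_surjective.2 hsurj).bijective_of_finite.sum_comp f
  have key := ColoredGraph.two_mul_sum_card_faces_add_le hinv hfpf hconn hsame
  rw [← hsum, Fintype.card_fin] at key
  rw [Finset.sum_congr rfl fun p _ => by rw [pow_succ', Equiv.Perm.mul_apply]]
  obtain ⟨d, rfl⟩ := Nat.exists_eq_add_of_le hD
  rw [show 2 + d - 1 = d + 1 by omega]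
  linarith
end

section
/- Fix an integer D ≥ 3 and let (V, σ_0, …, σ_D) be a connected edge (D+1)-colored graph with V nonempty whose reduced degree is zero, i.e. the total number of faces F satisfies 4·F = 4·D + D·(D−1)·|V|. Then the graph has a face of length two: there exist colors i ≠ j and vertices v ≠ w with σ_i(v) = w and σ_j(v) = w. -/
/-- Two involutions without fixed points that disagree everywhere have orbits of size at least
four. -/
theorem four_mul_card_orbitRel_quotient_le {V : Type*} [Finite V] (a b : Equiv.Perm V)
    (ha : a * a = 1) (hfa : ∀ v, a v ≠ v) (hfb : ∀ v, b v ≠ v) (hab : ∀ v, a v ≠ b v) :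
    4 * Nat.card (MulAction.orbitRel.Quotient
      (Subgroup.closure {a, b} : Subgroup (Equiv.Perm V)) V) ≤ Nat.card V := by
  set H : Subgroup (Equiv.Perm V) := Subgroup.closure {a, b}
  have haH : a ∈ H := Subgroup.subset_closure (by simp)
  have hbH : b ∈ H := Subgroup.subset_closure (by simp)
  let g : Fin 4 → Equiv.Perm V := ![1, a, b, a * b]
  have hg : ∀ k, g k ∈ H := by
    intro k
    fin_cases k
    exacts [H.one_mem, haH, hbH, H.mul_mem haH hbH]
  have haa : ∀ v, a (a v) = v := fun v => by rw [← Equiv.Perm.mul_apply, ha, Equiv.Perm.one_apply]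
  have hav : ∀ v, a (b v) ≠ v := fun v h => hab v (by rw [← haa (b v), h])
  have hginj : ∀ v, Function.Injective fun k => g k v := by
    intro v k l hkl
    have h1 := hfa v
    have h2 := hfb v
    have h3 := hab v
    have h4 := hav v
    have h5 := hfa (b v)
    have h6 : a (b v) ≠ a v := fun h => h2 (a.injective h)
    fin_cases k <;> fin_cases l <;> simp [g] at hkl ⊢ <;> grind
  let f : Fin 4 × MulAction.orbitRel.Quotient H V → V := fun p => g p.1 p.2.out
  have hmk : ∀ p, (Quotient.mk _ (f p) : MulAction.orbitRel.Quotient H V) = p.2 := by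
    intro p
    conv_rhs => rw [← p.2.out_eq]
    exact Quotient.sound ⟨⟨g p.1, hg p.1⟩, rfl⟩
  have hf : Function.Injective f := by
    rintro ⟨k, q⟩ ⟨l, r⟩ h
    obtain rfl : q = r := (hmk (k, q)).symm.trans ((congrArg _ h).trans (hmk (l, r)))
    exact congrArg (·, q) (hginj _ h)
  simpa [Nat.card_prod] using Nat.card_le_card_of_injective f hf

/-- The number of pairs `i < j` in `Fin (n + 1)`, without division. -/
theorem two_mul_card_filter_fst_lt_snd (n : ℕ) :
    2 * (Finset.univ.filter (fun ij : Fin (n + 1) × Fin (n + 1) => ij.1 < ij.2)).card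
      = (n + 1) * n := by
  have h : (Finset.univ.filter (fun ij : Fin (n + 1) × Fin (n + 1) => ij.1 < ij.2)).card
      = ∑ j : Fin (n + 1), (j : ℕ) := by
    rw [Finset.card_filter, Fintype.sum_prod_type_right]
    refine Finset.sum_congr rfl fun j _ => ?_
    rw [← Finset.card_filter, Finset.filter_gt_eq_Iio, Fin.card_Iio]
  rw [h, Fin.sum_univ_eq_sum_range (fun k => k), mul_comm, Finset.sum_range_id_mul_two,
    Nat.add_sub_cancel]


/-- **A connected edge `(D+1)`-colored graph of reduced degree zero has a face of length 2.**
For `D ≥ 3`, if the total number of faces `F` of a connected edge `(D+1)`-colored graph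
satisfies `4·F = 4·D + D·(D-1)·|V|` (vanishing reduced degree), then there are two colors
`i ≠ j` and two vertices `v ≠ w` with `σ i v = w` and `σ j v = w`. -/
theorem degree_zero_has_face_of_length_two
    (D : ℕ) (hD : 3 ≤ D)
    (V : Type) [Fintype V] [Nonempty V]
    (σ : Fin (D + 1) → Equiv.Perm V)
    (hinv : ∀ i, σ i * σ i = 1) (hfpf : ∀ i v, σ i v ≠ v)
    (hconn : MulAction.IsPretransitive
      (Subgroup.closure (Set.range σ) : Subgroup (Equiv.Perm V)) V)
    (hdeg : 4 * (∑ ij ∈ Finset.univ.filter (fun ij : Fin (D + 1) × Fin (D + 1) => ij.1 < ij.2),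
        Nat.card (MulAction.orbitRel.Quotient
          (Subgroup.closure {σ ij.1, σ ij.2} : Subgroup (Equiv.Perm V)) V))
      = 4 * D + D * (D - 1) * Nat.card V) :
    ∃ (i j : Fin (D + 1)) (v w : V), i ≠ j ∧ v ≠ w ∧ σ i v = w ∧ σ j v = w := by
  by_contra hno
  have hne : ∀ i j v, i ≠ j → σ i v ≠ σ j v := fun i j v hij h =>
    hno ⟨i, j, v, σ j v, hij, (hfpf j v).symm, h, rfl⟩
  have hsum := Finset.sum_le_card_nsmul
    (Finset.univ.filter (fun ij : Fin (D + 1) × Fin (D + 1) => ij.1 < ij.2))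
    (fun ij => 4 * Nat.card (MulAction.orbitRel.Quotient
      (Subgroup.closure {σ ij.1, σ ij.2} : Subgroup (Equiv.Perm V)) V)) (Nat.card V)
    fun ij hij => four_mul_card_orbitRel_quotient_le _ _ (hinv _) (hfpf _) (hfpf _)
      fun v => hne _ _ v (Finset.mem_filter.mp hij).2.ne
  rw [← Finset.mul_sum, hdeg, smul_eq_mul] at hsum
  have hcard := two_mul_card_filter_fst_lt_snd D
  obtain ⟨d, rfl⟩ := Nat.exists_eq_add_of_le' hD
  rw [show d + 3 - 1 = d + 2 by omega] at hsum
  nlinarith [Nat.zero_le ((d + 3) * d * Nat.card V)]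
end

section
/- Fix an integer D ≥ 3. Every melonic edge (D+1)-colored graph (V, σ_0, …, σ_D) is connected and has reduced degree zero, i.e. its total number of faces F satisfies 4·F = 4·D + D·(D−1)·|V|. -/
/-- An edge `(D+1)`-colored graph: a finite vertex type together with a permutation for
each of the `D+1` colors (the edges of color `i` are the pairs `{v, σ i v}`). -/
structure ColGraph (D : ℕ) where
  V : Type
  [fin : Fintype V]
  σ : Fin (D + 1) → Equiv.Perm V

attribute [instance] ColGraph.fin

/-- The two-vertex edge `(D+1)`-colored graph: every color swaps the two vertices. -/
def ColGraph.twoVertex (D : ℕ) : ColGraph D where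
  V := Bool
  σ := fun _ => Equiv.swap false true

/-- `D`-dipole insertion on the edge of color `i` going out of the vertex `u`
(with `w := σ i u`): two new vertices `a = inr false` and `b = inr true` are added,
joined to each other by an edge of every color `j ≠ i`, while the color-`i` edge from
`u` to `w` is rerouted as `σ' i u = a` and `σ' i b = w`. -/
noncomputable def ColGraph.dipoleInsert {D : ℕ} (G : ColGraph D) (i : Fin (D + 1)) (u : G.V) :
    ColGraph D where
  V := G.V ⊕ Bool
  σ :=
    letI : DecidableEq G.V := Classical.decEq _
    fun j =>
    if j = i then
      Equiv.swap (Sum.inl u) (Sum.inr true)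
        * Equiv.sumCongr (G.σ i) (Equiv.swap false true)
        * Equiv.swap (Sum.inl u) (Sum.inr true)
    else
      Equiv.sumCongr (G.σ j) (Equiv.swap false true)

/-- The melonic graphs: the smallest class of edge `(D+1)`-colored graphs containing the
two-vertex graph and closed under `D`-dipole insertion. -/
inductive ColGraph.Melonic (D : ℕ) : ColGraph D → Prop
  | base : Melonic D (ColGraph.twoVertex D)
  | insert {G : ColGraph D} (hG : Melonic D G) (i : Fin (D + 1)) (u : G.V) :
      Melonic D (G.dipoleInsert i u)

/-- The total number of faces of an edge `(D+1)`-colored graph: for each pair of colors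
`i < j`, the faces with colors `(i,j)` are the orbits of the subgroup generated by
`σ i` and `σ j`. -/
noncomputable def ColGraph.faces {D : ℕ} (G : ColGraph D) : ℕ :=
  ∑ ij ∈ Finset.univ.filter (fun ij : Fin (D + 1) × Fin (D + 1) => ij.1 < ij.2),
    Nat.card (MulAction.orbitRel.Quotient
      (Subgroup.closure {G.σ ij.1, G.σ ij.2} : Subgroup (Equiv.Perm G.V)) G.V)

/-- An edge `(D+1)`-colored graph is connected if the subgroup generated by the `σ i`
acts transitively on the vertices. -/
def ColGraph.Connected {D : ℕ} (G : ColGraph D) : Prop :=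
  MulAction.IsPretransitive
    (Subgroup.closure (Set.range G.σ) : Subgroup (Equiv.Perm G.V)) G.V

open MulAction in
/-- A function invariant under every permutation of `S` is constant on the orbits of the
subgroup generated by `S`. -/
theorem eq_of_orbitRel_closure {α β : Type*} {S : Set (Equiv.Perm α)} {f : α → β}
    (h : ∀ s ∈ S, ∀ x, f (s x) = f x) {x y : α}
    (hxy : orbitRel (Subgroup.closure S) α x y) : f x = f y := by
  obtain ⟨⟨g, hg⟩, rfl⟩ := hxy
  change f (g y) = f y
  induction hg using Subgroup.closure_induction generalizing y with
  | mem s hs => exact h s hs y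
  | one => rfl
  | mul a b _ _ ha hb => rw [Equiv.Perm.mul_apply, ha, hb]
  | inv a _ ha => simpa using (ha (y := a⁻¹ y)).symm

section Components

variable {ι V : Type*}

/-- The components of `V` under the permutations with colors in `J`. -/
abbrev ColorComp (σ : ι → Equiv.Perm V) (J : Set ι) : Type _ :=
  MulAction.orbitRel.Quotient (Subgroup.closure (σ '' J) : Subgroup (Equiv.Perm V)) V

namespace ColorComp

/-- The component of a vertex. -/
def mk (σ : ι → Equiv.Perm V) (J : Set ι) (v : V) : ColorComp σ J := Quotient.mk'' v

theorem mk_surjective (σ : ι → Equiv.Perm V) (J : Set ι) : Function.Surjective (mk σ J) :=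
  Quotient.mk''_surjective

theorem mk_apply (σ : ι → Equiv.Perm V) {J : Set ι} {j : ι} (hj : j ∈ J) (v : V) :
    mk σ J (σ j v) = mk σ J v :=
  Quotient.sound' ⟨⟨σ j, Subgroup.subset_closure (Set.mem_image_of_mem _ hj)⟩, rfl⟩

/-- Functions on vertices invariant under the colors in `J` descend to components. -/
def lift {σ : ι → Equiv.Perm V} {J : Set ι} {β : Type*} (f : V → β)
    (h : ∀ j ∈ J, ∀ v, f (σ j v) = f v) : ColorComp σ J → β :=
  Quotient.lift f fun _ _ hxy =>
    eq_of_orbitRel_closure (by rintro _ ⟨j, hj, rfl⟩ x; exact h j hj x) hxy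

theorem subsingleton_swap {J : Set ι} (hJ : J.Nonempty) :
    Subsingleton (ColorComp (fun _ : ι => Equiv.swap false true) J) := by
  obtain ⟨j, hj⟩ := hJ
  have h := mk_apply (fun _ : ι => Equiv.swap false true) hj false
  rw [Equiv.swap_apply_left] at h
  refine ⟨fun x y => ?_⟩
  obtain ⟨_ | _, rfl⟩ := mk_surjective _ _ x <;> obtain ⟨_ | _, rfl⟩ := mk_surjective _ _ y
  exacts [rfl, h.symm, h, rfl]

end ColorComp

/-- The permutations of a `D`-dipole insertion. -/
noncomputable def dipolePerm [DecidableEq ι] (σ : ι → Equiv.Perm V) (i : ι) (u : V) :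
    ι → Equiv.Perm (V ⊕ Bool) :=
  letI : DecidableEq V := Classical.decEq _
  fun j =>
  if j = i then
    Equiv.swap (Sum.inl u) (Sum.inr true)
      * Equiv.sumCongr (σ i) (Equiv.swap false true)
      * Equiv.swap (Sum.inl u) (Sum.inr true)
  else
    Equiv.sumCongr (σ j) (Equiv.swap false true)

section Insert

variable [DecidableEq ι] (σ : ι → Equiv.Perm V) {i j : ι} (u : V) {J : Set ι}

theorem dipolePerm_inl_of_ne (h : j ≠ i) (v : V) :
    dipolePerm σ i u j (Sum.inl v) = Sum.inl (σ j v) := by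
  simp [dipolePerm, h]

theorem dipolePerm_inr_of_ne (h : j ≠ i) (b : Bool) :
    dipolePerm σ i u j (Sum.inr b) = Sum.inr (!b) := by
  cases b <;> simp [dipolePerm, h]

theorem dipolePerm_inl_self :
    dipolePerm σ i u i (Sum.inl u) = Sum.inr false := by
  simp [dipolePerm, Equiv.swap_apply_def]

theorem dipolePerm_inl_of_apply_eq {v : V} (hv : v ≠ u) (h : σ i v = u) :
    dipolePerm σ i u i (Sum.inl v) = Sum.inr true := by
  simp [dipolePerm, Equiv.swap_apply_def, hv, h]

theorem dipolePerm_inl_of_apply_ne {v : V} (hv : v ≠ u) (h : σ i v ≠ u) :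
    dipolePerm σ i u i (Sum.inl v) = Sum.inl (σ i v) := by
  simp [dipolePerm, Equiv.swap_apply_def, hv, h]

theorem dipolePerm_inr_false_self :
    dipolePerm σ i u i (Sum.inr false) = Sum.inl u := by
  simp [dipolePerm, Equiv.swap_apply_def]

theorem dipolePerm_inr_true_of_apply_eq (h : σ i u = u) :
    dipolePerm σ i u i (Sum.inr true) = Sum.inr true := by
  simp [dipolePerm, h]

theorem dipolePerm_inr_true_of_apply_ne (h : σ i u ≠ u) :
    dipolePerm σ i u i (Sum.inr true) = Sum.inl (σ i u) := by
  simp [dipolePerm, Equiv.swap_apply_def, h]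

open ColorComp in
/-- If `J` contains the color `i` and another color, inserting a dipole on an edge of color `i`
does not change the components of colors `J`. -/
theorem nonempty_colorComp_dipolePerm_equiv (hi : i ∈ J) (hj : j ∈ J) (hji : j ≠ i) :
    Nonempty (ColorComp (dipolePerm σ i u) J ≃ ColorComp σ J) := by
  set τ := dipolePerm σ i u with hτ
  have hab : mk τ J (Sum.inr true) = mk τ J (Sum.inr false) := by
    simpa [hτ, dipolePerm_inr_of_ne σ u hji] using mk_apply τ hj (Sum.inr false)
  have hua : mk τ J (Sum.inr false) = mk τ J (Sum.inl u) := by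
    simpa [hτ, dipolePerm_inl_self] using mk_apply τ hi (Sum.inl u)
  have hto : ∀ k ∈ J, ∀ x : V ⊕ Bool,
      Sum.elim (mk σ J) (fun _ => mk σ J u) (τ k x) =
        Sum.elim (mk σ J) (fun _ => mk σ J u) x := by
    intro k hk x
    rcases eq_or_ne k i with rfl | hki
    · rcases x with v | _ | _
      · by_cases hv : v = u
        · subst hv
          rw [hτ, dipolePerm_inl_self]; rfl
        · by_cases h : σ k v = u
          · rw [hτ, dipolePerm_inl_of_apply_eq σ u hv h]
            simpa [h] using mk_apply σ hk v
          · rw [hτ, dipolePerm_inl_of_apply_ne σ u hv h]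
            exact mk_apply σ hk v
      · rw [hτ, dipolePerm_inr_false_self]; rfl
      · by_cases h : σ k u = u
        · rw [hτ, dipolePerm_inr_true_of_apply_eq σ u h]
        · rw [hτ, dipolePerm_inr_true_of_apply_ne σ u h]
          exact mk_apply σ hk u
    · rcases x with v | b
      · rw [hτ, dipolePerm_inl_of_ne σ u hki]
        exact mk_apply σ hk v
      · rw [hτ, dipolePerm_inr_of_ne σ u hki]; rfl
  have hinv : ∀ k ∈ J, ∀ v, mk τ J (Sum.inl (σ k v)) = mk τ J (Sum.inl v) := by
    intro k hk v
    have hkv := mk_apply τ hk (Sum.inl v)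
    rcases eq_or_ne k i with rfl | hki
    · by_cases hv : v = u
      · subst hv
        by_cases h : σ k v = v
        · rw [h]
        · have hb := mk_apply τ hk (Sum.inr true)
          rw [hτ, dipolePerm_inr_true_of_apply_ne σ v h] at hb
          exact hb.trans (hab.trans hua)
      · by_cases h : σ k v = u
        · rw [hτ, dipolePerm_inl_of_apply_eq σ u hv h] at hkv
          rw [h, ← hua, ← hab]
          exact hkv
        · rwa [hτ, dipolePerm_inl_of_apply_ne σ u hv h] at hkv
    · rwa [hτ, dipolePerm_inl_of_ne σ u hki] at hkv
  refine ⟨⟨lift _ hto, lift (fun v => mk τ J (Sum.inl v)) hinv, fun x => ?_, fun x => ?_⟩⟩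
  · obtain ⟨v | _ | _, rfl⟩ := mk_surjective _ _ x
    · rfl
    · exact hua.symm
    · exact (hab.trans hua).symm
  · obtain ⟨v, rfl⟩ := mk_surjective _ _ x
    rfl

open ColorComp in
/-- If `J` is nonempty and does not contain the color `i`, inserting a dipole on an edge of
color `i` adds one component of colors `J`. -/
theorem nonempty_colorComp_dipolePerm_equiv_option (hi : i ∉ J) (hj : j ∈ J) :
    Nonempty (ColorComp (dipolePerm σ i u) J ≃ Option (ColorComp σ J)) := by
  set τ := dipolePerm σ i u with hτ
  have hne : ∀ k ∈ J, k ≠ i := fun k hk h => hi (h ▸ hk)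
  have hab : mk τ J (Sum.inr true) = mk τ J (Sum.inr false) := by
    simpa [hτ, dipolePerm_inr_of_ne σ u (hne j hj)] using mk_apply τ hj (Sum.inr false)
  have hto : ∀ k ∈ J, ∀ x : V ⊕ Bool,
      Sum.elim (fun v => some (mk σ J v)) (fun _ => none) (τ k x) =
        Sum.elim (fun v => some (mk σ J v)) (fun _ => none) x := by
    rintro k hk (v | b)
    · rw [hτ, dipolePerm_inl_of_ne σ u (hne k hk)]
      exact congrArg some (mk_apply σ hk v)
    · rw [hτ, dipolePerm_inr_of_ne σ u (hne k hk)]; rfl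
  have hinv : ∀ k ∈ J, ∀ v, mk τ J (Sum.inl (σ k v)) = mk τ J (Sum.inl v) := by
    intro k hk v
    have hkv := mk_apply τ hk (Sum.inl v)
    rwa [hτ, dipolePerm_inl_of_ne σ u (hne k hk)] at hkv
  refine ⟨⟨lift _ hto,
    fun o => o.elim (mk τ J (Sum.inr false)) (lift (fun v => mk τ J (Sum.inl v)) hinv),
    fun x => ?_, fun x => ?_⟩⟩
  · obtain ⟨v | _ | _, rfl⟩ := mk_surjective _ _ x
    · rfl
    · rfl
    · exact hab.symm
  · rcases x with _ | x
    · rfl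
    · obtain ⟨v, rfl⟩ := mk_surjective _ _ x
      rfl

theorem card_colorComp_dipolePerm_pair [Finite V] {k : ι} (hjk : j ≠ k) :
    Nat.card (ColorComp (dipolePerm σ i u) {j, k}) =
      Nat.card (ColorComp σ {j, k}) + if j ≠ i ∧ k ≠ i then 1 else 0 := by
  split_ifs with h
  · obtain ⟨e⟩ := nonempty_colorComp_dipolePerm_equiv_option σ (i := i) (j := j) (J := {j, k}) u
      (by simp [h.1.symm, h.2.symm]) (by simp)
    rw [Nat.card_congr e, Finite.card_option]
  · rw [add_zero]
    by_cases hj : j = i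
    · subst hj
      obtain ⟨e⟩ := nonempty_colorComp_dipolePerm_equiv σ (i := j) (j := k) (J := {j, k}) u
        (by simp) (by simp) hjk.symm
      exact Nat.card_congr e
    · obtain rfl : k = i := by tauto
      obtain ⟨e⟩ := nonempty_colorComp_dipolePerm_equiv σ (i := k) (j := j) (J := {j, k}) u
        (by simp) (by simp) hjk
      exact Nat.card_congr e

end Insert

end Components

namespace ColGraph

variable {D : ℕ}

theorem connected_iff (G : ColGraph D) : G.Connected ↔ Subsingleton (ColorComp G.σ Set.univ) := by
  rw [Connected, MulAction.pretransitive_iff_subsingleton_quotient, ColorComp, Set.image_univ]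

theorem faces_eq (G : ColGraph D) :
    G.faces = ∑ ij ∈ Finset.univ.filter (fun ij : Fin (D + 1) × Fin (D + 1) => ij.1 < ij.2),
      Nat.card (ColorComp G.σ {ij.1, ij.2}) :=
  Finset.sum_congr rfl fun ij _ => by rw [ColorComp, Set.image_pair]

end ColGraph

/-- The number of increasing pairs in a finite set. -/
theorem Finset.two_mul_card_filter_lt_add_card {α : Type*} [LinearOrder α] (s : Finset α) :
    2 * ((s ×ˢ s).filter fun p => p.1 < p.2).card + s.card = s.card * s.card := by
  have hswap : ((s ×ˢ s).filter fun p => p.2 < p.1).card =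
      ((s ×ˢ s).filter fun p => p.1 < p.2).card :=
    Finset.card_equiv (Equiv.prodComm α α) (by simp [and_comm])
  have hunion : (s ×ˢ s).filter (fun p => p.1 < p.2) ∪ (s ×ˢ s).filter (fun p => p.2 < p.1) =
      s.offDiag := by
    ext ⟨a, b⟩
    simp only [Finset.mem_union, Finset.mem_filter, Finset.mem_product, Finset.mem_offDiag,
      ne_iff_lt_or_gt]
    tauto
  have hdisj : Disjoint ((s ×ˢ s).filter fun p => p.1 < p.2)
      ((s ×ˢ s).filter fun p => p.2 < p.1) :=
    Finset.disjoint_filter.2 fun _ _ h h' => lt_asymm h h'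
  have hcard := Finset.card_union_of_disjoint hdisj
  rw [hunion, hswap, Finset.offDiag_card] at hcard
  have := Nat.le_mul_self s.card
  omega

namespace ColGraph

variable {D : ℕ}

theorem two_mul_faces_twoVertex : 2 * (twoVertex D).faces = D * (D + 1) := by
  have h := Finset.two_mul_card_filter_lt_add_card (Finset.univ : Finset (Fin (D + 1)))
  rw [faces_eq, Finset.sum_congr rfl fun ij _ => ?_, Finset.sum_const, smul_eq_mul, mul_one]
  · rw [Finset.univ_product_univ, Finset.card_univ, Fintype.card_fin] at h
    linarith
  · have := ColorComp.subsingleton_swap (J := {ij.1, ij.2}) ⟨ij.1, by simp⟩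
    exact Nat.card_eq_one_iff_unique.2 ⟨this, ⟨ColorComp.mk _ _ false⟩⟩

theorem two_mul_faces_dipoleInsert (G : ColGraph D) (i : Fin (D + 1)) (u : G.V) :
    2 * (G.dipoleInsert i u).faces = 2 * G.faces + D * (D - 1) := by
  have h := Finset.two_mul_card_filter_lt_add_card (Finset.univ.erase i)
  have hset : ((Finset.univ.erase i ×ˢ Finset.univ.erase i).filter
      fun p : Fin (D + 1) × Fin (D + 1) => p.1 < p.2) =
      (Finset.univ.filter fun p : Fin (D + 1) × Fin (D + 1) => p.1 < p.2).filter
        fun p => p.1 ≠ i ∧ p.2 ≠ i := by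
    ext p
    simp [and_comm]
  have hD : (Finset.univ.erase i).card = D := by simp
  rw [hset, hD] at h
  have hfaces : (G.dipoleInsert i u).faces = _ :=
    (faces_eq _).trans <| Finset.sum_congr rfl fun ij hij =>
      card_colorComp_dipolePerm_pair G.σ u (Finset.mem_filter.1 hij).2.ne
  rw [hfaces, Finset.sum_add_distrib,
    ← faces_eq, Finset.sum_boole, Nat.cast_id, Nat.mul_sub, mul_one]
  omega

end ColGraph

/-- **Melonic graphs are connected and have reduced degree zero.**  For `D ≥ 3`, every
melonic edge `(D+1)`-colored graph is connected and its total number of faces `F`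
satisfies `4·F = 4·D + D·(D-1)·|V|`. -/
theorem melonic_connected_and_degree_zero
    (D : ℕ) (hD : 3 ≤ D) (G : ColGraph D) (hG : ColGraph.Melonic D G) :
    G.Connected ∧ 4 * G.faces = 4 * D + D * (D - 1) * Nat.card G.V := by
  induction hG with
  | base =>
    refine ⟨(ColGraph.connected_iff _).2
      (ColorComp.subsingleton_swap Set.univ_nonempty), ?_⟩
    have h := ColGraph.two_mul_faces_twoVertex (D := D)
    have hV : Nat.card (ColGraph.twoVertex D).V = 2 := by
      change Nat.card Bool = 2
      simp
    rw [hV]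
    obtain ⟨d, rfl⟩ : ∃ d, D = d + 1 := ⟨D - 1, by omega⟩
    rw [Nat.add_sub_cancel]
    linarith
  | @insert G _ i u ih =>
    obtain ⟨hconn, hdeg⟩ := ih
    constructor
    · have : Nontrivial (Fin (D + 1)) := Fin.nontrivial_iff_two_le.2 (by omega)
      obtain ⟨j, hj⟩ := exists_ne i
      obtain ⟨e⟩ := nonempty_colorComp_dipolePerm_equiv G.σ u (Set.mem_univ i) (Set.mem_univ j) hj
      rw [ColGraph.connected_iff] at hconn ⊢
      exact e.subsingleton
    · have h := G.two_mul_faces_dipoleInsert i u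
      have hV : Nat.card (G.dipoleInsert i u).V = Nat.card G.V + 2 := by
        change Nat.card (G.V ⊕ Bool) = _
        simp
      rw [hV]
      linarith
end

section
/- Fix an integer D ≥ 3 and let (V, σ_0, …, σ_D) be a connected edge (D+1)-colored graph with V nonempty. If its reduced degree is zero, i.e. its total number of faces F satisfies 4·F = 4·D + D·(D−1)·|V|, then the graph is melonic (isomorphic to a graph obtained from the two-vertex graph by iterated D-dipole insertions). -/
namespace ColGraph

open Equiv

section Orbits

variable {V : Type*}

/-- The orbit equivalence relation of the group generated by a set of permutations. -/
def orbitSetoid (S : Set (Perm V)) : Setoid V :=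
  MulAction.orbitRel (Subgroup.closure S) V

/-- The number of orbits of the group generated by a set of permutations. -/
noncomputable def numOrbits (S : Set (Perm V)) : ℕ :=
  Nat.card (Quotient (orbitSetoid S))

theorem orbitSetoid_apply {S : Set (Perm V)} {f : Perm V} (hf : f ∈ S) (z : V) :
    orbitSetoid S (f z) z :=
  MulAction.orbitRel_apply.2 ⟨⟨f, Subgroup.subset_closure hf⟩, rfl⟩

theorem orbitSetoid_le {S : Set (Perm V)} {r : Setoid V} (h : ∀ f ∈ S, ∀ z, r (f z) z) :
    orbitSetoid S ≤ r := by
  rintro a b hab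
  obtain ⟨⟨g, hg⟩, rfl⟩ := MulAction.orbitRel_apply.1 hab
  change r (g b) b
  clear hab
  induction hg using Subgroup.closure_induction generalizing b with
  | mem f hf => exact h f hf b
  | one => exact r.refl' b
  | mul f g _ _ hf hg => exact r.trans' (hf (b := g b)) (hg (b := b))
  | inv f _ hf => simpa using r.symm' (hf (b := f⁻¹ b))

theorem orbitSetoid_mono {S T : Set (Perm V)} (h : S ⊆ T) : orbitSetoid S ≤ orbitSetoid T :=
  orbitSetoid_le fun _ hf z => orbitSetoid_apply (h hf) z

theorem eq_or_eq_of_orbitSetoid {S : Set (Perm V)} {v w z : V} (hv : ∀ f ∈ S, f v = w)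
    (hw : ∀ f ∈ S, f w = v) (h : orbitSetoid S z v) : z = v ∨ z = w := by
  have hle : orbitSetoid S ≤ Setoid.ker fun z => z = v ∨ z = w :=
    orbitSetoid_le fun f hf z => by
      rw [Setoid.ker_def, eq_iff_iff, ← f.apply_eq_iff_eq (x := z) (y := v),
        ← f.apply_eq_iff_eq (x := z) (y := w), hv f hf, hw f hf, or_comm]
  have hz := hle h
  simpa [Setoid.ker_def] using hz

theorem card_quotient_le_of_le [Finite V] {r s : Setoid V} (h : r ≤ s) :
    Nat.card (Quotient s) ≤ Nat.card (Quotient r) :=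
  Nat.card_le_card_of_surjective (Quotient.map' (s₂ := s) id fun _ _ => @h _ _) <| by
    rintro ⟨a⟩
    exact ⟨Quotient.mk'' a, rfl⟩

theorem card_quotient_lt_of_le [Finite V] {r s : Setoid V} (h : r ≤ s) {a b : V}
    (hs : s a b) (hr : ¬ r a b) : Nat.card (Quotient s) < Nat.card (Quotient r) := by
  set f : Quotient r → Quotient s := Quotient.map' (s₂ := s) id fun _ _ => @h _ _ with hf
  have hsurj : Function.Surjective f := by
    rintro ⟨a⟩
    exact ⟨Quotient.mk'' a, rfl⟩
  refine lt_of_le_of_ne (card_quotient_le_of_le h) fun heq => hr ?_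
  have hinj := ((Nat.bijective_iff_surjective_and_card f).2 ⟨hsurj, heq.symm⟩).injective
  exact Quotient.exact (hinj (Quotient.sound hs :
    f (Quotient.mk r a) = f (Quotient.mk r b)))

/-- The equivalence relation obtained from `r` by merging the classes of `a` and `b`. -/
def mergeSetoid (r : Setoid V) (a b : V) : Setoid V where
  r z z' := r z z' ∨ ((r z a ∨ r z b) ∧ (r z' a ∨ r z' b))
  iseqv := by
    refine ⟨fun z => Or.inl (r.refl' z), ?_, ?_⟩
    · rintro z z' (h | ⟨h, h'⟩)
      · exact Or.inl (r.symm' h)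
      · exact Or.inr ⟨h', h⟩
    · rintro x y z (h | ⟨h, h'⟩) (k | ⟨k, k'⟩)
      · exact Or.inl (r.trans' h k)
      · exact Or.inr ⟨k.imp (r.trans' h) (r.trans' h), k'⟩
      · exact Or.inr ⟨h, h'.imp (r.trans' (r.symm' k)) (r.trans' (r.symm' k))⟩
      · exact Or.inr ⟨h, k'⟩

theorem card_quotient_le_mergeSetoid [Finite V] (r : Setoid V) (a b : V) :
    Nat.card (Quotient r) ≤ Nat.card (Quotient (mergeSetoid r a b)) + 1 := by
  classical
  let f : Quotient r → Option (Quotient (mergeSetoid r a b)) := fun q =>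
    if q = Quotient.mk r b then none
    else some (Quotient.map' (s₂ := mergeSetoid r a b) id (fun _ _ => Or.inl) q)
  have hf : Function.Injective f := by
    rintro ⟨x⟩ ⟨y⟩ hxy
    change f (Quotient.mk r x) = f (Quotient.mk r y) at hxy
    change Quotient.mk r x = Quotient.mk r y
    by_cases hx : Quotient.mk r x = Quotient.mk r b <;>
      by_cases hy : Quotient.mk r y = Quotient.mk r b
    · rw [hx, hy]
    · simp [f, hx, hy] at hxy
    · simp [f, hx, hy] at hxy
    · simp only [f, hx, hy, if_false, Option.some.injEq] at hxy
      have hx' : ¬ r x b := fun h => hx (Quotient.sound h)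
      have hy' : ¬ r y b := fun h => hy (Quotient.sound h)
      have h : mergeSetoid r a b x y := Quotient.exact hxy
      rcases h with h | ⟨h | h, h' | h'⟩
      · exact Quotient.sound h
      · exact Quotient.sound (r.trans' h (r.symm' h'))
      all_goals contradiction
  simpa using Nat.card_le_card_of_injective f hf

theorem card_eq_sum_card_class [Fintype V] (r : Setoid V) [Fintype (Quotient r)]
    [DecidableRel r] :
    Fintype.card V = ∑ q : Quotient r, (Finset.univ.filter fun z => r z q.out).card := by
  rw [← Finset.card_univ,
    Finset.card_eq_sum_card_fiberwise (f := Quotient.mk r) (t := Finset.univ) (by simp)]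
  refine Finset.sum_congr rfl fun q _ => congrArg _ (Finset.filter_congr fun z _ => ?_)
  conv_lhs => rw [← Quotient.out_eq q]
  exact Quotient.eq

theorem two_mul_numOrbits_singleton [Finite V] {f : Perm V} (hf : f * f = 1)
    (hf' : ∀ v, f v ≠ v) : 2 * numOrbits {f} = Nat.card V := by
  classical
  have := Fintype.ofFinite V
  have hff : ∀ v, f (f v) = v := fun v => by rw [← Perm.mul_apply, hf, Perm.one_apply]
  let r : Setoid V :=
    { r := fun x y => x = y ∨ x = f y
      iseqv := ⟨fun _ => Or.inl rfl, by grind, by grind⟩ }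
  have hle : orbitSetoid {f} ≤ r := orbitSetoid_le fun g hg z => Or.inr (by rw [hg])
  have hr : ∀ x y, orbitSetoid {f} x y ↔ x = y ∨ x = f y := by
    refine fun x y => ⟨fun h => hle h, ?_⟩
    · rintro (rfl | rfl)
      · exact Setoid.refl' _ _
      · exact orbitSetoid_apply (Set.mem_singleton f) y
  rw [Nat.card_eq_fintype_card, card_eq_sum_card_class (orbitSetoid {f}),
    Finset.sum_const_nat (m := 2), mul_comm, numOrbits, Nat.card_eq_fintype_card, Finset.card_univ]
  intro q _
  rw [← Finset.card_pair (hf' q.out)]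
  congr 1
  ext z
  simp [hr, or_comm]

theorem four_mul_numOrbits_pair_le [Finite V] {f g : Perm V}
    (hf' : ∀ v, f v ≠ v) (hg : g * g = 1) (hg' : ∀ v, g v ≠ v) (hfg : ∀ v, f v ≠ g v) :
    4 * numOrbits {f, g} ≤ Nat.card V := by
  classical
  have := Fintype.ofFinite V
  have hgg : ∀ v, g (g v) = v := fun v => by rw [← Perm.mul_apply, hg, Perm.one_apply]
  rw [Nat.card_eq_fintype_card, card_eq_sum_card_class (orbitSetoid {f, g}), mul_comm, numOrbits,
    Nat.card_eq_fintype_card, ← Finset.card_univ, ← smul_eq_mul]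
  refine Finset.card_nsmul_le_sum _ _ _ fun q _ => ?_
  set v := q.out
  have hF : ∀ z, orbitSetoid {f, g} (f z) z := orbitSetoid_apply (by simp)
  have hG : ∀ z, orbitSetoid {f, g} (g z) z := orbitSetoid_apply (by simp)
  have hcard : ({v, f v, g v, g (f v)} : Finset V).card = 4 := by
    have h1 := hf' v
    have h2 := hg' v
    have h3 := hfg v
    have h4 := hg' (f v)
    have h5 : g (f v) ≠ v := fun h => h3 (by rw [← h, hgg, h])
    have h6 : g (f v) ≠ g v := fun h => h1 (g.injective h)
    rw [Finset.card_insert_of_notMem, Finset.card_insert_of_notMem, Finset.card_pair] <;>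
      grind
  rw [← hcard]
  refine Finset.card_le_card fun z hz => ?_
  simp only [Finset.mem_insert, Finset.mem_singleton] at hz
  simp only [Finset.mem_filter, Finset.mem_univ, true_and]
  rcases hz with rfl | rfl | rfl | rfl
  · exact Setoid.refl' _ _
  · exact hF _
  · exact hG _
  · exact Setoid.trans' _ (hG _) (hF _)

theorem even_card_of_involutive {f : Perm V} (hf : f * f = 1)
    (hf' : ∀ v, f v ≠ v) (W : Finset V) (hW : ∀ z ∈ W, f z ∈ W) : Even W.card := by
  have hff : ∀ v, f (f v) = v := fun v => by rw [← Perm.mul_apply, hf, Perm.one_apply]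
  have : ∑ _z ∈ W, (1 : ZMod 2) = 0 :=
    Finset.sum_involution (fun z _ => f z) (fun _ _ => by decide)
      (fun z _ _ => hf' z) (fun z hz => hW z hz) (fun z _ => hff z)
  rw [Finset.sum_const, nsmul_one] at this
  exact (ZMod.natCast_eq_zero_iff_even).1 this

end Orbits

section Flip

variable {V : Type*} [DecidableEq V]

/-- Reroute the involution `τ` so that it exchanges `v` with `w` and `τ v` with `τ w`. -/
def flip (τ : Perm V) (v w : V) : Perm V :=
  swap w (τ v) * τ * swap w (τ v)

variable {τ : Perm V} {v w : V}

theorem flip_mul_self (hτ : τ * τ = 1) : flip τ v w * flip τ v w = 1 := by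
  simp only [flip, mul_assoc, swap_mul_self_mul]
  rw [← mul_assoc τ, hτ, one_mul, swap_mul_self]

theorem flip_ne (hτ' : ∀ z, τ z ≠ z) (z : V) : flip τ v w z ≠ z := fun h => by
  refine hτ' (swap w (τ v) z) ?_
  apply (swap w (τ v)).injective
  simpa [flip] using h

theorem flip_fst (hτ' : ∀ z, τ z ≠ z) (hvw : v ≠ w) : flip τ v w v = w := by
  simp [flip, swap_apply_of_ne_of_ne hvw (hτ' v).symm]

theorem flip_snd (hτ : τ * τ = 1) (hτ' : ∀ z, τ z ≠ z) (hvw : v ≠ w) : flip τ v w w = v := by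
  have hττ : τ (τ v) = v := by rw [← Perm.mul_apply, hτ, Perm.one_apply]
  simp [flip, swap_apply_of_ne_of_ne hvw (hτ' v).symm, hττ]

theorem flip_apply_fst (hτ' : ∀ z, τ z ≠ z) (hvw : v ≠ w) :
    flip τ v w (τ v) = τ w := by
  simp [flip, swap_apply_of_ne_of_ne (hτ' w) (fun h => hvw (τ.injective h).symm)]

theorem flip_apply_snd (hτ : τ * τ = 1) (hτ' : ∀ z, τ z ≠ z) (hvw : v ≠ w) :
    flip τ v w (τ w) = τ v := by
  have hττ : τ (τ w) = w := by rw [← Perm.mul_apply, hτ, Perm.one_apply]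
  simp [flip, swap_apply_of_ne_of_ne (hτ' w) (fun h => hvw (τ.injective h).symm), hττ]

theorem flip_of_ne (hτ : τ * τ = 1) {z : V} (h1 : z ≠ v) (h2 : z ≠ w) (h3 : z ≠ τ v)
    (h4 : z ≠ τ w) : flip τ v w z = τ z := by
  have hττ : ∀ z, τ (τ z) = z := fun z => by rw [← Perm.mul_apply, hτ, Perm.one_apply]
  have h5 : τ z ≠ w := fun h => h4 (by rw [← h, hττ])
  simp [flip, swap_apply_of_ne_of_ne h2 h3, swap_apply_of_ne_of_ne h5 fun h => h1 (τ.injective h)]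

theorem orbitSetoid_flip_le {r : Setoid V} {S : Set (Perm V)} (hτ : τ * τ = 1)
    (hτ' : ∀ z, τ z ≠ z) (hvw : v ≠ w) (hr : orbitSetoid (insert τ S) ≤ r) (h : r v w) :
    orbitSetoid (insert (flip τ v w) S) ≤ r := by
  have hT : ∀ z, r (τ z) z := fun z => hr (orbitSetoid_apply (by simp) z)
  have hxy : r (τ v) (τ w) := r.trans' (hT v) (r.trans' h (r.symm' (hT w)))
  refine orbitSetoid_le fun f hf z => ?_
  rcases hf with rfl | hf
  · by_cases h1 : z = v
    · rw [h1, flip_fst hτ' hvw]; exact r.symm' h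
    by_cases h2 : z = w
    · rw [h2, flip_snd hτ hτ' hvw]; exact h
    by_cases h3 : z = τ v
    · rw [h3, flip_apply_fst hτ' hvw]; exact r.symm' hxy
    by_cases h4 : z = τ w
    · rw [h4, flip_apply_snd hτ hτ' hvw]; exact hxy
    rw [flip_of_ne hτ h1 h2 h3 h4]; exact hT z
  · exact hr (orbitSetoid_apply (by simp [hf]) z)

theorem orbitSetoid_le_of_flip {r : Setoid V} {S : Set (Perm V)} (hτ : τ * τ = 1)
    (hτ' : ∀ z, τ z ≠ z) (hvw : v ≠ w) (hr : orbitSetoid (insert (flip τ v w) S) ≤ r)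
    (h : r v (τ v)) : orbitSetoid (insert τ S) ≤ r := by
  have hT : ∀ z, r (flip τ v w z) z := fun z => hr (orbitSetoid_apply (by simp) z)
  have h1 := hT v
  have h2 := hT (τ v)
  rw [flip_fst hτ' hvw] at h1
  rw [flip_apply_fst hτ' hvw] at h2
  have hwy : r w (τ w) := r.trans' h1 (r.trans' h (r.symm' h2))
  have hττ : ∀ z, τ (τ z) = z := fun z => by rw [← Perm.mul_apply, hτ, Perm.one_apply]
  refine orbitSetoid_le fun f hf z => ?_
  rcases hf with rfl | hf
  · by_cases h1 : z = v
    · rw [h1]; exact r.symm' h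
    by_cases h2 : z = w
    · rw [h2]; exact r.symm' hwy
    by_cases h3 : z = f v
    · rw [h3, hττ]; exact h
    by_cases h4 : z = f w
    · rw [h4, hττ]; exact hwy
    rw [← flip_of_ne hτ h1 h2 h3 h4]; exact hT z
  · exact hr (orbitSetoid_apply (by simp [hf]) z)

theorem numOrbits_le_flip_add_one [Finite V] (S : Set (Perm V)) (hτ : τ * τ = 1)
    (hτ' : ∀ z, τ z ≠ z) (hvw : v ≠ w) :
    numOrbits (insert τ S) ≤ numOrbits (insert (flip τ v w) S) + 1 := by
  refine (card_quotient_le_mergeSetoid _ v w).trans (Nat.succ_le_succ ?_)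
  exact card_quotient_le_of_le (orbitSetoid_flip_le hτ hτ' hvw (fun _ _ => Or.inl)
    (Or.inr ⟨Or.inl (Setoid.refl' _ _), Or.inr (Setoid.refl' _ _)⟩))

theorem numOrbits_flip_le_add_one [Finite V] (S : Set (Perm V)) (hτ : τ * τ = 1)
    (hτ' : ∀ z, τ z ≠ z) (hvw : v ≠ w) :
    numOrbits (insert (flip τ v w) S) ≤ numOrbits (insert τ S) + 1 := by
  refine (card_quotient_le_mergeSetoid _ v (τ v)).trans (Nat.succ_le_succ ?_)
  exact card_quotient_le_of_le (orbitSetoid_le_of_flip hτ hτ' hvw (fun _ _ => Or.inl)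
    (Or.inr ⟨Or.inl (Setoid.refl' _ _), Or.inr (Setoid.refl' _ _)⟩))

theorem numOrbits_flip_le_of_connected [Finite V] (S : Set (Perm V)) (hτ : τ * τ = 1)
    (hτ' : ∀ z, τ z ≠ z) (hvw : v ≠ w)
    (h : orbitSetoid (insert (flip τ v w) S) v (τ v)) :
    numOrbits (insert (flip τ v w) S) ≤ numOrbits (insert τ S) :=
  card_quotient_le_of_le (orbitSetoid_le_of_flip hτ hτ' hvw le_rfl h)

theorem numOrbits_flip_of_not_connected [Finite V] {S : Set (Perm V)} (hτ : τ * τ = 1)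
    (hτ' : ∀ z, τ z ≠ z) (hvw : v ≠ w) {b : Perm V} (hb : b * b = 1) (hb' : ∀ z, b z ≠ z)
    (hbS : b ∈ S) (h : ¬ orbitSetoid (insert (flip τ v w) S) v (τ v)) :
    numOrbits (insert (flip τ v w) S) = numOrbits (insert τ S) + 1 := by
  classical
  have := Fintype.ofFinite V
  set r := orbitSetoid (insert τ S) with hr
  set r' := orbitSetoid (insert (flip τ v w) S) with hr'
  have hT : ∀ z, r (τ z) z := orbitSetoid_apply (by simp)
  have hT' : ∀ z, r' (flip τ v w z) z := orbitSetoid_apply (by simp)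
  have hB : ∀ z, r (b z) z := orbitSetoid_apply (by simp [hbS])
  have hB' : ∀ z, r' (b z) z := orbitSetoid_apply (by simp [hbS])
  have hvw' : r v w := by
    by_contra hcon
    let W : Finset V := Finset.univ.filter fun z => r z v ∧ r' z v
    have hW : ∀ z, z ∈ W ↔ r z v ∧ r' z v := by simp [W]
    have hvW : v ∈ W := (hW v).2 ⟨r.refl' v, r'.refl' v⟩
    have h1 : Even W.card := even_card_of_involutive hb hb' W fun z hz => by
      rw [hW] at hz ⊢
      exact ⟨r.trans' (hB z) hz.1, r'.trans' (hB' z) hz.2⟩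
    have h2 : Even (W.erase v).card := even_card_of_involutive hτ hτ' _ fun z hz => by
      have hττ : ∀ z, τ (τ z) = z := fun z => by rw [← Perm.mul_apply, hτ, Perm.one_apply]
      rw [Finset.mem_erase, hW] at hz ⊢
      obtain ⟨hzv, hz, hz'⟩ := hz
      have hx : z ≠ τ v := fun e => h (r'.symm' (e ▸ hz'))
      have hw : z ≠ w := fun e => hcon (r.symm' (e ▸ hz))
      have hy : z ≠ τ w := fun e => hcon (r.trans' (r.symm' hz) (e ▸ hT w))
      refine ⟨fun e => hx (by rw [← e, hττ]), r.trans' (hT z) hz, ?_⟩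
      rw [← flip_of_ne hτ hzv hw hx hy]
      exact r'.trans' (hT' z) hz'
    rw [← Finset.card_erase_add_one hvW] at h1
    exact (Nat.not_even_iff_odd.2 h2.add_one) h1
  refine le_antisymm (numOrbits_flip_le_add_one S hτ hτ' hvw) ?_
  exact card_quotient_lt_of_le (orbitSetoid_flip_le hτ hτ' hvw le_rfl hvw') (r.symm' (hT v)) h

theorem numOrbits_flip_pair [Finite V] (hτ : τ * τ = 1)
    (hτ' : ∀ z, τ z ≠ z) {a : Perm V} (ha : a * a = 1) (ha' : ∀ z, a z ≠ z) (hav : a v = w)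
    (hvw : τ v ≠ w) :
    numOrbits {flip τ v w, a} = numOrbits {τ, a} + 1 := by
  have hne : v ≠ w := hav ▸ (ha' v).symm
  have haw : a w = v := by rw [← hav, ← Perm.mul_apply, ha, Perm.one_apply]
  refine numOrbits_flip_of_not_connected hτ hτ' hne ha ha' rfl fun h => ?_
  refine (eq_or_eq_of_orbitSetoid ?_ ?_ (Setoid.symm' _ h)).elim (hτ' v) hvw <;>
    rintro f (rfl | rfl)
  exacts [flip_fst hτ' hne, hav, flip_snd hτ hτ' hne, haw]

theorem numOrbits_triangle [Finite V] {a b τ : Perm V} (ha : a * a = 1) (ha' : ∀ z, a z ≠ z)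
    (hb : b * b = 1) (hb' : ∀ z, b z ≠ z) (hτ : τ * τ = 1) (hτ' : ∀ z, τ z ≠ z)
    {S : Set (Perm V)} (haS : a ∈ S) (hbS : b ∈ S) :
    2 * numOrbits {τ, a} + 2 * numOrbits {τ, b} + 4 * numOrbits S ≤
      2 * numOrbits {a, b} + 4 * numOrbits (insert τ S) + Nat.card V := by
  by_cases h : ∀ z, τ z = a z
  · obtain rfl : τ = a := Equiv.ext h
    have := two_mul_numOrbits_singleton hτ hτ'
    rw [Set.pair_eq_singleton, Set.insert_eq_of_mem haS]
    omega
  push Not at h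
  obtain ⟨v, hv⟩ := h
  obtain ⟨w, hav⟩ : ∃ w, a v = w := ⟨_, rfl⟩
  have hne : v ≠ w := hav ▸ (ha' v).symm
  rw [hav] at hv
  have h1 := numOrbits_flip_pair hτ hτ' ha ha' hav hv
  have ih := numOrbits_triangle ha ha' hb hb' (flip_mul_self (v := v) (w := w) hτ)
    (flip_ne (v := v) (w := w) hτ') haS hbS
  by_cases hc : orbitSetoid (insert (flip τ v w) S) v (τ v)
  · have h2 := numOrbits_flip_le_of_connected S hτ hτ' hne hc
    have h3 := numOrbits_le_flip_add_one {b} hτ hτ' hne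
    omega
  · have h2 := numOrbits_flip_of_not_connected hτ hτ' hne ha ha' haS hc
    have h3 := numOrbits_flip_of_not_connected hτ hτ' hne hb hb' (Set.mem_singleton b)
      fun h => hc (orbitSetoid_mono (Set.insert_subset_insert (by simpa using hbS)) h)
    omega
termination_by Nat.card V - numOrbits {τ, a}
decreasing_by
  have : numOrbits {flip τ v w, a} ≤ Nat.card V :=
    Nat.card_le_card_of_surjective _ Quotient.mk_surjective
  omega

end Flip

section Slack

variable {V ι : Type*} {σ : ι → Perm V}

/-- The slack in `numOrbits_triangle` for the colors `i` and `j` of `S` and a further color `t`. -/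
noncomputable def slack (σ : ι → Perm V) (S : Finset ι) (t i j : ι) : ℤ :=
  2 * numOrbits {σ i, σ j} + 4 * numOrbits (insert (σ t) (σ '' S)) + Nat.card V
    - (2 * numOrbits {σ t, σ i} + 2 * numOrbits {σ t, σ j} + 4 * numOrbits (σ '' S))

theorem slack_nonneg [Finite V] (hinv : ∀ i, σ i * σ i = 1) (hfpf : ∀ i v, σ i v ≠ v) {S : Finset ι}
    {t i j : ι} (hi : i ∈ S) (hj : j ∈ S) : 0 ≤ slack σ S t i j := by
  classical
  have := numOrbits_triangle (hinv i) (hfpf i) (hinv j) (hfpf j) (hinv t) (hfpf t)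
    (S := σ '' S) (Set.mem_image_of_mem σ hi) (Set.mem_image_of_mem σ hj)
  rw [slack]
  omega

end Slack

section Defect

variable {V ι : Type*} [DecidableEq ι] {σ : ι → Perm V}

/-- Twice the number of faces with both colors in `S`. -/
noncomputable def doubleFaces (σ : ι → Perm V) (S : Finset ι) : ℕ :=
  ∑ p ∈ S.offDiag, numOrbits {σ p.1, σ p.2}

/-- Four times the reduced degree of the subgraph with colors in `S`, for the normalization
that is additive over connected components. -/
noncomputable def defect (σ : ι → Perm V) (S : Finset ι) : ℤ :=
  4 * (S.card - 1) * numOrbits (σ '' S) + (S.card - 1) * (S.card - 2) * Nat.card V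
    - 2 * doubleFaces σ S

theorem doubleFaces_insert {S : Finset ι} {t : ι} (ht : t ∉ S) :
    doubleFaces σ (insert t S) = doubleFaces σ S + 2 * ∑ c ∈ S, numOrbits {σ t, σ c} := by
  rw [doubleFaces, Finset.offDiag_insert ht, Finset.sum_union, Finset.sum_union,
    Finset.sum_product, Finset.sum_product_right, Finset.sum_singleton, Finset.sum_singleton,
    doubleFaces, two_mul, add_assoc]
  · simp only [Set.pair_comm (σ t)]
  · exact Finset.disjoint_left.2 (by grind)
  · exact Finset.disjoint_left.2 (by grind)

theorem sum_offDiag_fst (S : Finset ι) (f : ι → ℤ) :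
    ∑ p ∈ S.offDiag, f p.1 = (S.card - 1) * ∑ c ∈ S, f c := by
  have h := Finset.sum_union (Finset.disjoint_diag_offDiag S) (f := fun p => f p.1)
  rw [Finset.diag_union_offDiag, Finset.sum_product, Finset.sum_diag] at h
  simp only [Finset.sum_const, nsmul_eq_mul, ← Finset.mul_sum] at h
  linarith

theorem sum_offDiag_snd (S : Finset ι) (f : ι → ℤ) :
    ∑ p ∈ S.offDiag, f p.2 = (S.card - 1) * ∑ c ∈ S, f c := by
  have h := Finset.sum_union (Finset.disjoint_diag_offDiag S) (f := fun p => f p.2)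
  rw [Finset.diag_union_offDiag, Finset.sum_product, Finset.sum_diag] at h
  simp only [Finset.sum_const, nsmul_eq_mul] at h
  linarith

theorem sum_slack_add_defect {S : Finset ι} {t : ι} (ht : t ∉ S) :
    ∑ p ∈ S.offDiag, slack σ S t p.1 p.2 + S.card * defect σ S =
      (S.card - 1) * defect σ (insert t S) := by
  have h1 := sum_offDiag_fst S fun c => (numOrbits {σ t, σ c} : ℤ)
  have h2 := sum_offDiag_snd S fun c => (numOrbits {σ t, σ c} : ℤ)
  have h3 : (S.offDiag.card : ℤ) = S.card * (S.card - 1) := by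
    rw [Finset.offDiag_card, Nat.cast_sub (Nat.le_mul_self _)]
    push_cast
    ring
  simp only [slack, defect, doubleFaces_insert ht, Finset.card_insert_of_notMem ht,
    Finset.coe_insert, Set.image_insert_eq, Finset.sum_sub_distrib, Finset.sum_add_distrib,
    ← Finset.mul_sum, Finset.sum_const, nsmul_eq_mul, h1, h2, h3]
  rw [doubleFaces]
  push_cast
  ring

theorem defect_nonneg [Finite V] (hinv : ∀ i, σ i * σ i = 1)
    (hfpf : ∀ i v, σ i v ≠ v) {S : Finset ι}
    (hS : S.Nonempty) : 0 ≤ defect σ S := by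
  induction hS using Finset.Nonempty.cons_induction with
  | singleton a => simp [defect, doubleFaces]
  | cons t S ht hS ih =>
    rw [Finset.cons_eq_insert]
    rcases (Nat.succ_le_of_lt hS.card_pos).eq_or_lt with hc | hc
    · obtain ⟨a, rfl⟩ := Finset.card_eq_one.1 hc.symm
      have hta : t ≠ a := by simpa using ht
      rw [defect, doubleFaces_insert ht]
      simp [doubleFaces, Set.image_insert_eq, hta]
      linarith
    · have h1 := sum_slack_add_defect (σ := σ) ht
      have h2 : 0 ≤ ∑ p ∈ S.offDiag, slack σ S t p.1 p.2 := Finset.sum_nonneg fun p hp => by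
        rw [Finset.mem_offDiag] at hp
        exact slack_nonneg hinv hfpf hp.1 hp.2.1
      have h3 : (0 : ℤ) ≤ S.card * defect σ S := by positivity
      have h4 : (0 : ℤ) < S.card - 1 := by omega
      exact nonneg_of_mul_nonneg_right (by linarith) h4

theorem slack_eq_zero [Finite V] (hinv : ∀ i, σ i * σ i = 1)
    (hfpf : ∀ i v, σ i v ≠ v) {S : Finset ι}
    {t : ι} (ht : t ∉ S) (hdef : defect σ (insert t S) = 0) {i j : ι} (hi : i ∈ S) (hj : j ∈ S)
    (hij : i ≠ j) : slack σ S t i j = 0 := by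
  have h1 := sum_slack_add_defect (σ := σ) ht
  have h2 : ∀ p ∈ S.offDiag, 0 ≤ slack σ S t p.1 p.2 := fun p hp => by
    rw [Finset.mem_offDiag] at hp
    exact slack_nonneg hinv hfpf hp.1 hp.2.1
  have h3 : (0 : ℤ) ≤ S.card * defect σ S :=
    mul_nonneg (by positivity) (defect_nonneg hinv hfpf ⟨i, hi⟩)
  have h4 := Finset.sum_nonneg h2
  rw [hdef, mul_zero] at h1
  exact (Finset.sum_eq_zero_iff_of_nonneg h2).1 (by linarith) (i, j)
    (Finset.mem_offDiag.2 ⟨hi, hj, hij⟩)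

end Defect

section Restrict

variable {V ι : Type*} {σ : ι → Perm V}

/-- The subgraph induced on a set of vertices which is a union of components. -/
def restrict (σ : ι → Perm V) (P : V → Prop) (hP : ∀ i z, P (σ i z) ↔ P z) (i : ι) :
    Perm {z // P z} :=
  (σ i).subtypePerm (hP i)

theorem orbitSetoid_restrict (P : V → Prop) (hP : ∀ i z, P (σ i z) ↔ P z) (T : Set ι) :
    orbitSetoid (restrict σ P hP '' T) = (orbitSetoid (σ '' T)).comap Subtype.val := by
  refine le_antisymm (orbitSetoid_le ?_) ?_
  · rintro _ ⟨i, hi, rfl⟩ z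
    exact orbitSetoid_apply (Set.mem_image_of_mem σ hi) z.1
  · set s := orbitSetoid (restrict σ P hP '' T) with hs
    let r : Setoid V :=
      { r := fun z z' => (P z ↔ P z') ∧ ∀ (hz : P z) (hz' : P z'), s ⟨z, hz⟩ ⟨z', hz'⟩
        iseqv := ⟨fun z => ⟨Iff.rfl, fun _ _ => s.refl' _⟩,
          fun h => ⟨h.1.symm, fun hz hz' => s.symm' (h.2 hz' hz)⟩,
          fun h k => ⟨h.1.trans k.1,
            fun hz hz' => s.trans' (h.2 hz (h.1.1 hz)) (k.2 (h.1.1 hz) hz')⟩⟩ }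
    have hr : orbitSetoid (σ '' T) ≤ r := orbitSetoid_le <| by
      rintro _ ⟨i, hi, rfl⟩ z
      exact ⟨hP i z, fun hz hz' =>
        orbitSetoid_apply (Set.mem_image_of_mem (restrict σ P hP) hi) ⟨z, hz'⟩⟩
    exact fun {x y} hxy => (hr hxy).2 x.2 y.2

theorem numOrbits_restrict_add [Finite V] (P : V → Prop) (hP : ∀ i z, P (σ i z) ↔ P z)
    (T : Set ι) :
    numOrbits (restrict σ P hP '' T) +
      numOrbits (restrict σ (fun z => ¬ P z) (fun i z => not_congr (hP i z)) '' T) =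
      numOrbits (σ '' T) := by
  rw [numOrbits, numOrbits, numOrbits, orbitSetoid_restrict, orbitSetoid_restrict, ← Nat.card_sum]
  set r := orbitSetoid (σ '' T) with hr
  have hrP : ∀ {x y}, r x y → (P x ↔ P y) := fun {x y} h => by
    have hle : r ≤ Setoid.ker P := orbitSetoid_le <| by
      rintro _ ⟨i, -, rfl⟩ z
      exact propext (hP i z)
    exact iff_of_eq (hle h)
  refine Nat.card_eq_of_bijective (Sum.elim
    (Quotient.map' (s₂ := r) Subtype.val fun _ _ h => h)
    (Quotient.map' (s₂ := r) Subtype.val fun _ _ h => h)) ⟨?_, ?_⟩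
  · rintro (⟨⟨x⟩⟩ | ⟨⟨x⟩⟩) (⟨⟨y⟩⟩ | ⟨⟨y⟩⟩) h
    · exact congrArg Sum.inl (Quotient.sound (Quotient.exact h : r x y))
    · exact absurd ((hrP (Quotient.exact h : r x y)).1 x.2) y.2
    · exact absurd ((hrP (Quotient.exact h : r x y)).2 y.2) x.2
    · exact congrArg Sum.inr (Quotient.sound (Quotient.exact h : r x y))
  · rintro ⟨x⟩
    by_cases hx : P x
    · exact ⟨Sum.inl (Quotient.mk _ ⟨x, hx⟩), rfl⟩
    · exact ⟨Sum.inr (Quotient.mk _ ⟨x, hx⟩), rfl⟩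

theorem defect_restrict_add [Finite V] [DecidableEq ι] (P : V → Prop)
    (hP : ∀ i z, P (σ i z) ↔ P z) (S : Finset ι) :
    defect (restrict σ P hP) S +
      defect (restrict σ (fun z => ¬ P z) fun i z => not_congr (hP i z)) S = defect σ S := by
  classical
  have h1 := numOrbits_restrict_add P hP (S : Set ι)
  have h2 : Nat.card {z // P z} + Nat.card {z // ¬ P z} = Nat.card V := by
    rw [← Nat.card_sum, Nat.card_congr (Equiv.sumCompl P)]
  have h3 : doubleFaces (restrict σ P hP) S +
      doubleFaces (restrict σ (fun z => ¬ P z) fun i z => not_congr (hP i z)) S =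
      doubleFaces σ S := by
    simp only [doubleFaces, ← Set.image_pair]
    rw [← Finset.sum_add_distrib]
    exact Finset.sum_congr rfl fun p _ => numOrbits_restrict_add P hP {p.1, p.2}
  simp only [defect, ← h1, ← h2, ← h3]
  push_cast
  ring

end Restrict

section Cut

variable {V ι : Type*} [DecidableEq ι] {σ : ι → Perm V}

/-- Replace the color `t` by its flip along the edge of color `i` at `v`. -/
noncomputable def cut [DecidableEq V] (σ : ι → Perm V) (i t : ι) (v : V) : ι → Perm V :=
  Function.update σ t (flip (σ t) v (σ i v))

theorem cut_self [DecidableEq V] (i t : ι) (v : V) :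
    cut σ i t v t = flip (σ t) v (σ i v) := Function.update_self ..

theorem cut_of_ne [DecidableEq V] (i : ι) {t c : ι} (h : c ≠ t) (v : V) :
    cut σ i t v c = σ c := Function.update_of_ne h ..

/-- The vertices in the component of `v` after cutting. -/
def cutSide [DecidableEq V] (σ : ι → Perm V) (i t : ι) (v z : V) : Prop :=
  orbitSetoid (Set.range (cut σ i t v)) z v

theorem cutSide_apply [DecidableEq V] (i t : ι) (v : V) (c : ι) (z : V) :
    cutSide σ i t v (cut σ i t v c z) ↔ cutSide σ i t v z :=
  have h := orbitSetoid_apply (Set.mem_range_self (f := cut σ i t v) c) z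
  ⟨fun k => Setoid.trans' _ (Setoid.symm' _ h) k, fun k => Setoid.trans' _ h k⟩

end Cut

section Tight

variable {V ι : Type*} [Fintype ι] [DecidableEq ι] {σ : ι → Perm V}

/-- Connected edge-colored graphs of reduced degree zero. -/
structure IsTight (σ : ι → Perm V) : Prop where
  mul_self : ∀ i, σ i * σ i = 1
  apply_ne : ∀ i v, σ i v ≠ v
  numOrbits_range : numOrbits (Set.range σ) = 1
  defect_univ : defect σ Finset.univ = 0

theorem range_eq_insert (σ : ι → Perm V) (t : ι) :
    Set.range σ = insert (σ t) (σ '' (Finset.univ.erase t : Finset ι)) := by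
  rw [← Set.image_insert_eq, ← Finset.coe_insert, Finset.insert_erase (Finset.mem_univ t),
    Finset.coe_univ, Set.image_univ]

theorem IsTight.split [DecidableEq V] [Finite V] (h : IsTight σ) {i j t : ι} {v : V} (hij : i ≠ j)
    (hv : σ i v = σ j v) (ht : σ t v ≠ σ i v) :
    ¬ cutSide σ i t v (σ t v) ∧
    IsTight (restrict (cut σ i t v) (cutSide σ i t v) (cutSide_apply i t v)) ∧
    IsTight (restrict (cut σ i t v) (fun z => ¬ cutSide σ i t v z)
      fun c z => not_congr (cutSide_apply i t v c z)) := by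
  have hinv := h.mul_self
  have hfpf := h.apply_ne
  have hinv' : ∀ c, cut σ i t v c * cut σ i t v c = 1 := fun c => by
    by_cases hc : c = t
    · rw [hc, cut_self, flip_mul_self (hinv t)]
    · rw [cut_of_ne i hc, hinv]
  have hfpf' : ∀ c z, cut σ i t v c z ≠ z := fun c => by
    by_cases hc : c = t
    · rw [hc, cut_self]; exact flip_ne (hfpf t)
    · rw [cut_of_ne i hc]; exact hfpf c
  have hne : v ≠ σ i v := (hfpf i v).symm
  have hit : i ≠ t := by rintro rfl; exact ht rfl
  have hjt : j ≠ t := by rintro rfl; exact ht hv.symm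
  set S := Finset.univ.erase t with hS
  have hiS : i ∈ S := by simp [hS, hit]
  have hjS : j ∈ S := by simp [hS, hjt]
  have htS : t ∉ S := by simp [hS]
  have hins : insert t S = Finset.univ := Finset.insert_erase (Finset.mem_univ t)
  have himg : cut σ i t v '' S = σ '' S :=
    Set.image_congr fun c hc => cut_of_ne i (Finset.ne_of_mem_erase hc) v
  have hrange : Set.range (cut σ i t v) = insert (flip (σ t) v (σ i v)) (σ '' S) := by
    rw [range_eq_insert _ t, cut_self, himg]
  have e1 := slack_eq_zero hinv hfpf htS (hins ▸ h.defect_univ) hiS hjS hij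
  have e2 := slack_nonneg hinv' hfpf' (t := t) hiS hjS
  have f1 := numOrbits_flip_pair (hinv t) (hfpf t) (hinv i) (hfpf i) rfl ht
  have f2 := numOrbits_flip_pair (hinv t) (hfpf t) (hinv j) (hfpf j) hv.symm ht
  simp only [slack, cut_self, cut_of_ne i hit, cut_of_ne i hjt, himg] at e1 e2
  have hsep : ¬ orbitSetoid (insert (flip (σ t) v (σ i v)) (σ '' S)) v (σ t v) := fun hc => by
    have := numOrbits_flip_le_of_connected (σ '' S) (hinv t) (hfpf t) hne hc
    omega
  have hside : ¬ cutSide σ i t v (σ t v) := fun hc => hsep (hrange ▸ Setoid.symm' _ hc)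
  have g1 := numOrbits_flip_of_not_connected (hinv t) (hfpf t) hne (hinv i) (hfpf i)
    (Set.mem_image_of_mem σ hiS) hsep
  have g2 : ∀ c ∈ S, numOrbits {flip (σ t) v (σ i v), σ c} = numOrbits {σ t, σ c} + 1 :=
    fun c hc => numOrbits_flip_of_not_connected (hinv t) (hfpf t) hne (hinv c) (hfpf c)
      (Set.mem_singleton _) fun hcon => hsep (orbitSetoid_mono (Set.insert_subset_insert
        (by simpa using ⟨c, hc, rfl⟩)) hcon)
  have hdef : defect (cut σ i t v) Finset.univ = 0 := by
    have h0 := h.defect_univ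
    rw [← hins, defect, doubleFaces_insert htS, Finset.coe_insert, Set.image_insert_eq] at h0 ⊢
    rw [himg, cut_self, g1, Finset.sum_congr rfl (g := fun c => numOrbits {σ t, σ c} + 1)
      fun c hc => by rw [cut_of_ne i (Finset.ne_of_mem_erase hc), g2 c hc],
      show doubleFaces (cut σ i t v) S = doubleFaces σ S from Finset.sum_congr rfl fun p hp => by
        rw [Finset.mem_offDiag] at hp
        rw [cut_of_ne i (Finset.ne_of_mem_erase hp.1), cut_of_ne i (Finset.ne_of_mem_erase hp.2.1)],
      Finset.sum_add_distrib, Finset.sum_const]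
    rw [Finset.card_insert_of_notMem htS] at h0 ⊢
    push_cast at h0 ⊢
    simp only [smul_eq_mul, mul_one] at h0 ⊢
    linarith
  have hconn : numOrbits (Set.range (cut σ i t v)) = 2 := by
    have := h.numOrbits_range
    rw [range_eq_insert σ t] at this
    rw [hrange, g1, this]
  have hd := defect_restrict_add (cutSide σ i t v) (cutSide_apply i t v) Finset.univ
  have hc := numOrbits_restrict_add (cutSide σ i t v) (cutSide_apply i t v) Set.univ
  have hpos : ∀ {W : Type _} [Finite W] [Nonempty W] (T : Set (Perm W)), 0 < numOrbits T :=
    fun T => by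
      have : Nonempty (Quotient (orbitSetoid T)) := ‹Nonempty _›.map (Quotient.mk _)
      exact Nat.card_pos
  have : Nonempty {z // cutSide σ i t v z} := ⟨⟨v, Setoid.refl' _ _⟩⟩
  have : Nonempty {z // ¬ cutSide σ i t v z} := ⟨⟨σ t v, hside⟩⟩
  have inv1 : ∀ (P : V → Prop) (hP : ∀ c z, P (cut σ i t v c z) ↔ P z) (c : ι),
      restrict (cut σ i t v) P hP c * restrict (cut σ i t v) P hP c = 1 := fun P hP c =>
    Equiv.ext fun z => Subtype.ext (Equiv.congr_fun (hinv' c) z)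
  have fpf1 : ∀ (P : V → Prop) (hP : ∀ c z, P (cut σ i t v c z) ↔ P z) (c : ι) z,
      restrict (cut σ i t v) P hP c z ≠ z := fun P hP c z hz =>
    hfpf' c z (congrArg Subtype.val hz)
  have d1 := defect_nonneg (inv1 _ (cutSide_apply i t v)) (fpf1 _ _) ⟨t, Finset.mem_univ t⟩
  have d2 := defect_nonneg (inv1 (fun z => ¬ cutSide σ i t v z)
    fun c z => not_congr (cutSide_apply i t v c z))
    (fpf1 _ _) ⟨t, Finset.mem_univ t⟩
  simp only [Set.image_univ, hconn] at hc
  have p1 := hpos (Set.range (restrict (cut σ i t v) _ (cutSide_apply i t v)))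
  have p2 := hpos (Set.range (restrict (cut σ i t v) (fun z => ¬ cutSide σ i t v z)
    fun c z => not_congr (cutSide_apply i t v c z)))
  exact ⟨hside, ⟨inv1 _ _, fpf1 _ _, by omega, by linarith⟩,
    ⟨inv1 _ _, fpf1 _ _, by omega, by linarith⟩⟩

end Tight

section Dipole

variable {D : ℕ}

theorem IsTight.exists_bigon {V : Type*} [Finite V] [Nonempty V] (hD : 3 ≤ D)
    {σ : Fin (D + 1) → Perm V} (h : IsTight σ) : ∃ v i j, i ≠ j ∧ σ i v = σ j v := by
  by_contra! hcon
  have h1 : ∑ p ∈ (Finset.univ : Finset (Fin (D + 1))).offDiag, 4 * numOrbits {σ p.1, σ p.2} ≤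
      (Finset.univ : Finset (Fin (D + 1))).offDiag.card * Nat.card V := by
    rw [← smul_eq_mul]
    refine Finset.sum_le_card_nsmul _ _ _ fun p hp => ?_
    rw [Finset.mem_offDiag] at hp
    exact four_mul_numOrbits_pair_le (h.apply_ne _) (h.mul_self _) (h.apply_ne _)
      fun v => hcon v _ _ hp.2.2
  have h2 := h.defect_univ
  rw [← Finset.mul_sum, ← doubleFaces, Finset.offDiag_card, Finset.card_univ, Fintype.card_fin,
    show (D + 1) * (D + 1) - (D + 1) = D * (D + 1) by rw [Nat.add_mul]; omega] at h1
  rw [defect, Finset.coe_univ, Set.image_univ, h.numOrbits_range, Finset.card_univ,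
    Fintype.card_fin] at h2
  zify at h1
  push_cast at h2
  have h3 : (0 : ℤ) ≤ D * (D - 3) * Nat.card V := by
    have : (0 : ℤ) ≤ D - 3 := by omega
    positivity
  nlinarith

/-- A tight graph has a dipole avoiding any prescribed edge, that of color `t₀` at `u`. -/
theorem IsTight.exists_dipole (hD : 3 ≤ D) {V : Type*} [Finite V]
    {σ : Fin (D + 1) → Perm V} (h : IsTight σ) (u : V) (t₀ : Fin (D + 1)) :
    ∃ a k, (∀ i j, i ≠ k → j ≠ k → σ i a = σ j a) ∧ (t₀ ≠ k → a ≠ u ∧ a ≠ σ t₀ u) := by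
  classical
  have : Nonempty V := ⟨u⟩
  obtain ⟨v, i, j, hij, hv⟩ := h.exists_bigon hD
  by_cases ht : ∀ t, σ t v = σ i v
  · exact ⟨v, t₀, fun i j _ _ => (ht i).trans (ht j).symm, fun h => absurd rfl h⟩
  push Not at ht
  obtain ⟨t, ht⟩ := ht
  obtain ⟨hside, hA, hB⟩ := h.split hij hv ht
  have hne : v ≠ σ i v := (h.apply_ne i v).symm
  have hinv : ∀ c z, σ c (σ c z) = z := fun c z => by
    rw [← Perm.mul_apply, h.mul_self, Perm.one_apply]
  have key : ∀ (P : V → Prop) (hP : ∀ c z, P (cut σ i t v c z) ↔ P z),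
      IsTight (restrict (cut σ i t v) P hP) → ∀ p, P p → ¬ P u →
      (∀ z, P z → z ≠ p → z ≠ cut σ i t v t p → cut σ i t v t z = σ t z) →
      ∃ a k, (∀ i j, i ≠ k → j ≠ k → σ i a = σ j a) ∧ (t₀ ≠ k → a ≠ u ∧ a ≠ σ t₀ u) := by
    intro P hP htight p hp hu heq
    have hdec : Nat.card {z // P z} < Nat.card V := Finite.card_subtype_lt hu
    obtain ⟨⟨a, ha⟩, k, hk, hk'⟩ := htight.exists_dipole hD ⟨p, hp⟩ t
    have hcut : ∀ c, c ≠ k → cut σ i t v c a = σ c a := fun c hc => by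
      by_cases hct : c = t
      · subst hct
        exact heq a ha (fun e => (hk' hc).1 (Subtype.ext e)) fun e => (hk' hc).2 (Subtype.ext e)
      · rw [cut_of_ne i hct]
    refine ⟨a, k, fun c d hc hd => ?_, fun h0 => ⟨fun e => hu (e ▸ ha), fun e => hu ?_⟩⟩
    · rw [← hcut c hc, ← hcut d hd]
      exact congrArg Subtype.val (hk c d hc hd)
    · rw [← hinv t₀ u, ← e, ← hcut t₀ h0]
      exact (hP t₀ a).2 ha
  by_cases hu : cutSide σ i t v u
  · refine key _ _ hB (σ t v) hside (fun h => h hu) fun z hz hz1 hz2 => ?_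
    rw [cut_self, flip_apply_fst (h.apply_ne t) hne] at hz2
    rw [cut_self, flip_of_ne (h.mul_self t) _ _ hz1 hz2]
    · rintro rfl
      exact hz (Setoid.refl' _ _)
    · rintro rfl
      have hw := (cutSide_apply (σ := σ) i t v t v).2 (Setoid.refl' _ _)
      rw [cut_self, flip_fst (h.apply_ne t) hne] at hw
      exact hz hw
  · refine key _ _ hA v (Setoid.refl' _ _) hu fun z hz hz1 hz2 => ?_
    rw [cut_self, flip_fst (h.apply_ne t) hne] at hz2
    rw [cut_self, flip_of_ne (h.mul_self t) hz1 hz2]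
    · rintro rfl
      exact hside hz
    · rintro rfl
      refine hside ((cutSide_apply i t v t _).1 ?_)
      rw [cut_self, flip_apply_fst (h.apply_ne t) hne]
      exact hz
termination_by Nat.card V

end Dipole

section Melonic

variable {D : ℕ}

theorem exists_equiv_of_bijective {V : Type} {σ : Fin (D + 1) → Perm V} {G : ColGraph D}
    (hG : Melonic D G) (f : G.V → V) (hf : Function.Bijective f)
    (hσ : ∀ c x, σ c (f x) = f (G.σ c x)) :
    ∃ G : ColGraph D, Melonic D G ∧ ∃ e : V ≃ G.V, ∀ c v, e (σ c v) = G.σ c (e v) := by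
  refine ⟨G, hG, (Equiv.ofBijective f hf).symm, fun c v => ?_⟩
  obtain ⟨x, rfl⟩ := hf.2 v
  rw [hσ, Equiv.ofBijective_symm_apply_apply, Equiv.ofBijective_symm_apply_apply]

theorem dipoleInsert_apply_of_ne (G : ColGraph D) {c k : Fin (D + 1)} (u : G.V) (h : c ≠ k)
    (x : G.V ⊕ Bool) :
    (G.dipoleInsert k u).σ c x = Equiv.sumCongr (G.σ c) (swap false true) x :=
  DFunLike.congr_fun (if_neg h) x

section DipoleInsertSelf

variable (G : ColGraph D) {k : Fin (D + 1)} {u : G.V}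

theorem dipoleInsert_apply_self [DecidableEq G.V] (x : G.V ⊕ Bool) :
    (G.dipoleInsert k u).σ k x =
      swap (Sum.inl u) (Sum.inr true) (Equiv.sumCongr (G.σ k) (swap false true)
        (swap (Sum.inl u) (Sum.inr true) x)) := by
  obtain rfl : ‹DecidableEq G.V› = Classical.decEq _ := Subsingleton.elim _ _
  exact (DFunLike.congr_fun (if_pos rfl) x).trans rfl

theorem dipoleInsert_apply_inl_self : (G.dipoleInsert k u).σ k (Sum.inl u) = Sum.inr false := by
  classical
  refine (G.dipoleInsert_apply_self _).trans ?_
  simp [swap_apply_of_ne_of_ne]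
  rfl

theorem dipoleInsert_apply_inl_of_eq {g : G.V} (hg : g ≠ u) (hgu : G.σ k g = u) :
    (G.dipoleInsert k u).σ k (Sum.inl g) = Sum.inr true := by
  classical
  refine (G.dipoleInsert_apply_self _).trans ?_
  simp [swap_apply_of_ne_of_ne, hg, hgu]
  rfl

theorem dipoleInsert_apply_inl_of_ne {g : G.V} (hg : g ≠ u) (hgu : G.σ k g ≠ u) :
    (G.dipoleInsert k u).σ k (Sum.inl g) = Sum.inl (G.σ k g) := by
  classical
  refine (G.dipoleInsert_apply_self _).trans ?_
  simp [swap_apply_of_ne_of_ne, hg, hgu]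
  rfl

theorem dipoleInsert_apply_inr_false : (G.dipoleInsert k u).σ k (Sum.inr false) = Sum.inl u := by
  classical
  refine (G.dipoleInsert_apply_self _).trans ?_
  simp [swap_apply_of_ne_of_ne]
  rfl

theorem dipoleInsert_apply_inr_true (hu : G.σ k u ≠ u) :
    (G.dipoleInsert k u).σ k (Sum.inr true) = Sum.inl (G.σ k u) := by
  classical
  refine (G.dipoleInsert_apply_self _).trans ?_
  simp [swap_apply_of_ne_of_ne, hu]
  rfl

end DipoleInsertSelf

theorem IsTight.exists_melonic (hD : 3 ≤ D) {V : Type} [Finite V] [Nonempty V]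
    {σ : Fin (D + 1) → Perm V} (h : IsTight σ) :
    ∃ G : ColGraph D, Melonic D G ∧ ∃ e : V ≃ G.V, ∀ c v, e (σ c v) = G.σ c (e v) := by
  classical
  obtain ⟨a, k, hak, -⟩ := h.exists_dipole hD (Classical.arbitrary V) 0
  obtain ⟨i, hik, -⟩ := Fin.exists_ne_and_ne_of_two_lt k k (by omega)
  obtain ⟨j, hji, hjk⟩ := Fin.exists_ne_and_ne_of_two_lt i k (by omega)
  have hinv : ∀ c z, σ c (σ c z) = z := fun c z => by
    rw [← Perm.mul_apply, h.mul_self, Perm.one_apply]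
  obtain ⟨b, hb⟩ : ∃ b, σ i a = b := ⟨_, rfl⟩
  have hne : a ≠ b := hb ▸ (h.apply_ne i a).symm
  have hab : ∀ c, c ≠ k → σ c a = b := fun c hc => (hak c i hc hik).trans hb
  by_cases hk : σ k a = b
  · have hab' : ∀ c, σ c a = b := fun c => by
      by_cases hc : c = k
      exacts [hc ▸ hk, hab c hc]
    have hba' : ∀ c, σ c b = a := fun c => by rw [← hab' c, hinv]
    refine exists_equiv_of_bijective Melonic.base (fun x : Bool => cond x b a) ⟨?_, ?_⟩ ?_
    · rintro (_ | _) (_ | _) h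
      exacts [rfl, absurd h hne, absurd h.symm hne, rfl]
    · intro z
      have := (Nat.card_eq_one_iff_unique.1 h.numOrbits_range).1
      have hza : orbitSetoid (Set.range σ) z a :=
        Quotient.exact (Subsingleton.elim (Quotient.mk _ z) (Quotient.mk _ a))
      obtain rfl | rfl := eq_or_eq_of_orbitSetoid (by simpa using hab') (by simpa using hba') hza
      exacts [⟨false, rfl⟩, ⟨true, rfl⟩]
    · rintro c (_ | _)
      exacts [hab' c, hba' c]
  · obtain ⟨hside, -, hB⟩ := h.split (t := k) (v := a) hji.symm (hak i j hik hjk) (hb ▸ hk)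
    set cutσ := cut σ i k a with hcut
    have hcut_ne : ∀ c, c ≠ k → cutσ c = σ c := fun c hc => cut_of_ne i hc a
    have hcut_k : cutσ k = flip (σ k) a b := by rw [hcut, cut_self, hb]
    have hcab : ∀ c, cutσ c a = b := fun c => by
      by_cases hc : c = k
      · rw [hc, hcut_k, flip_fst (h.apply_ne k) hne]
      · rw [hcut_ne c hc, hab c hc]
    have hcba : ∀ c, cutσ c b = a := fun c => by
      by_cases hc : c = k
      · rw [hc, hcut_k, flip_snd (h.mul_self k) (h.apply_ne k) hne]
      · rw [hcut_ne c hc, ← hab c hc, hinv]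
    have ha : cutSide σ i k a a := Setoid.refl' _ _
    have hb' : cutSide σ i k a b := by
      have := (cutSide_apply i k a k a).2 ha
      rwa [← hcut, hcab] at this
    have hdec : Nat.card {z // ¬ cutSide σ i k a z} < Nat.card V :=
      Finite.card_subtype_lt (not_not_intro ha)
    have : Nonempty {z // ¬ cutSide σ i k a z} := ⟨⟨_, hside⟩⟩
    obtain ⟨G, hG, e, he⟩ := hB.exists_melonic hD
    have he' : ∀ c (g : G.V), ((e.symm (G.σ c g)).1 : V) = cutσ c (e.symm g).1 := fun c g => by
      obtain ⟨z, rfl⟩ := e.surjective g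
      rw [← he, e.symm_apply_apply, e.symm_apply_apply]
      rfl
    set u : G.V := e ⟨σ k a, hside⟩ with hu
    have hu' : ((e.symm u).1 : V) = σ k a := by rw [hu, e.symm_apply_apply]
    let f : G.V ⊕ Bool → V := Sum.elim (fun g => (e.symm g).1) (fun x => cond x b a)
    refine exists_equiv_of_bijective (Melonic.insert hG k u) f ⟨?_, ?_⟩ ?_
    · rintro (g | _ | _) (g' | _ | _) h
      · exact congrArg Sum.inl (e.symm.injective (Subtype.ext h))
      · exact absurd ha (Eq.subst (motive := fun z => ¬cutSide σ i k a z) h (e.symm g).2)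
      · exact absurd hb' (Eq.subst (motive := fun z => ¬cutSide σ i k a z) h (e.symm g).2)
      · exact absurd ha (Eq.subst (motive := fun z => ¬cutSide σ i k a z) h.symm (e.symm g').2)
      · rfl
      · exact absurd h hne
      · exact absurd hb' (Eq.subst (motive := fun z => ¬cutSide σ i k a z) h.symm (e.symm g').2)
      · exact absurd h.symm hne
      · rfl
    · intro z
      by_cases hz : cutSide σ i k a z
      · obtain rfl | rfl := eq_or_eq_of_orbitSetoid (by simpa using hcab) (by simpa using hcba) hz
        exacts [⟨Sum.inr false, rfl⟩, ⟨Sum.inr true, rfl⟩]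
      · exact ⟨Sum.inl (e ⟨z, hz⟩), by simp [f]⟩
    · intro c x
      by_cases hc : c = k
      · subst hc
        rcases x with g | _ | _
        · by_cases hgu : g = u
          · subst hgu
            refine Eq.trans ?_ (congrArg f G.dipoleInsert_apply_inl_self).symm
            exact (congrArg (σ c) hu').trans (hinv c a)
          have hgu' : (e.symm g).1 ≠ σ c a := fun hcon =>
            hgu (e.symm.injective (Subtype.ext (hcon.trans hu'.symm)))
          have h1 := he' c g
          by_cases hgv : G.σ c g = u
          · refine Eq.trans ?_ (congrArg f (G.dipoleInsert_apply_inl_of_eq hgu hgv)).symm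
            rw [hgv, hu', hcut_k, ← flip_apply_snd (h.mul_self c) (h.apply_ne c) hne,
              (flip (σ c) a b).injective.eq_iff] at h1
            exact (congrArg (σ c) h1.symm).trans (hinv c b)
          · refine Eq.trans ?_ (congrArg f (G.dipoleInsert_apply_inl_of_ne hgu hgv)).symm
            rw [hcut_k, flip_of_ne (h.mul_self c) _ _ hgu'] at h1
            · exact h1.symm
            · intro hcon
              rw [hcon, flip_apply_snd (h.mul_self c) (h.apply_ne c) hne, ← hu'] at h1
              exact hgv (e.symm.injective (Subtype.ext h1))
            · exact fun hcon => (e.symm g).2 (by rw [hcon]; exact ha)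
            · exact fun hcon => (e.symm g).2 (by rw [hcon]; exact hb')
        · exact hu'.symm.trans (congrArg f G.dipoleInsert_apply_inr_false).symm
        · have h1 := he' c u
          rw [hu', hcut_k, flip_apply_fst (h.apply_ne c) hne] at h1
          have hu_ne : G.σ c u ≠ u := fun hcon => by
            rw [hcon, hu'] at h1
            exact hne ((σ c).injective h1)
          exact h1.symm.trans (congrArg f (G.dipoleInsert_apply_inr_true hu_ne)).symm
      · refine Eq.trans ?_ (congrArg f (G.dipoleInsert_apply_of_ne u hc x)).symm
        rcases x with g | _ | _
        · simp [f, he', hcut_ne c hc]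
        · simpa [f] using hab c hc
        · simpa [f, ← hcut_ne c hc] using hcba c
termination_by Nat.card V

end Melonic

section Faces

theorem numOrbits_range_eq_one {V ι : Type*} [Nonempty V] {σ : ι → Perm V}
    (h : MulAction.IsPretransitive (Subgroup.closure (Set.range σ)) V) :
    numOrbits (Set.range σ) = 1 := by
  refine Nat.card_eq_one_iff_unique.2 ⟨⟨?_⟩, ‹Nonempty V›.map (Quotient.mk _)⟩
  rintro ⟨x⟩ ⟨y⟩
  exact Quotient.sound (MulAction.orbitRel_apply.2 (h.exists_smul_eq y x))

theorem doubleFaces_univ {V ι : Type*} [Fintype ι] [LinearOrder ι] (σ : ι → Perm V) :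
    doubleFaces σ Finset.univ =
      2 * ∑ p ∈ Finset.univ.filter (fun p : ι × ι => p.1 < p.2), numOrbits {σ p.1, σ p.2} := by
  rw [doubleFaces, ← Finset.sum_filter_add_sum_filter_not _ (fun p : ι × ι => p.1 < p.2), two_mul]
  congr 1
  · exact Finset.sum_congr (by grind) fun _ _ => rfl
  · refine Finset.sum_bij' (fun p _ => p.swap) (fun p _ => p.swap) ?_ ?_ ?_ ?_ ?_
    · simp only [Finset.mem_filter, Finset.mem_offDiag, Finset.mem_univ, true_and, and_imp]
      exact fun p h1 h2 => lt_of_le_of_ne (not_lt.1 h2) h1.symm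
    · simp only [Finset.mem_filter, Finset.mem_offDiag, Finset.mem_univ, true_and]
      exact fun p h => ⟨h.ne', h.not_gt⟩
    · simp
    · simp
    · exact fun p _ => by rw [Set.pair_comm, Prod.fst_swap, Prod.snd_swap]

end Faces

end ColGraph

/-- **Connected edge colored graphs of reduced degree zero are melonic.**  For `D ≥ 3`,
a connected edge `(D+1)`-colored graph on a nonempty finite vertex type whose total
number of faces `F` satisfies `4·F = 4·D + D·(D-1)·|V|` (vanishing reduced degree) is
isomorphic to a melonic graph, i.e. to a graph obtained from the two-vertex graph by
iterated `D`-dipole insertions. -/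
theorem degree_zero_iff_melonic
    (D : ℕ) (hD : 3 ≤ D)
    (V : Type) [Fintype V] [Nonempty V]
    (σ : Fin (D + 1) → Equiv.Perm V)
    (hinv : ∀ i, σ i * σ i = 1) (hfpf : ∀ i v, σ i v ≠ v)
    (hconn : MulAction.IsPretransitive
      (Subgroup.closure (Set.range σ) : Subgroup (Equiv.Perm V)) V)
    (hdeg : 4 * (∑ ij ∈ Finset.univ.filter (fun ij : Fin (D + 1) × Fin (D + 1) => ij.1 < ij.2),
        Nat.card (MulAction.orbitRel.Quotient
          (Subgroup.closure {σ ij.1, σ ij.2} : Subgroup (Equiv.Perm V)) V))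
      = 4 * D + D * (D - 1) * Nat.card V) :
    ∃ G : ColGraph D, ColGraph.Melonic D G ∧
      ∃ e : V ≃ G.V, ∀ (i : Fin (D + 1)) (v : V), e (σ i v) = G.σ i (e v) := by
  have h := ColGraph.numOrbits_range_eq_one hconn
  have hdefect : ColGraph.defect σ Finset.univ = 0 := by
    have h1 := ColGraph.doubleFaces_univ σ
    have h2 : 2 * ColGraph.doubleFaces σ Finset.univ = 4 * D + D * (D - 1) * Nat.card V := by
      rw [h1, ← mul_assoc]
      exact hdeg
    rw [ColGraph.defect, Finset.coe_univ, Set.image_univ, h, Finset.card_univ, Fintype.card_fin]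
    zify [show 1 ≤ D by omega] at h2
    push_cast
    rw [h2]
    ring
  exact ColGraph.IsTight.exists_melonic hD ⟨hinv, hfpf, h, hdefect⟩
end
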